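/- arXiv:math/0505372 — 5 statements merged into one kernel-verified Lean document; each statement's English description precedes it below -/
import Mathlib

section
/- Let N be a positive integer, let ε > 0 and let 0 < δ < N. Then there exists a constant c = c(N, ε, δ) > 0 such that for every a > 0, every b ≥ 0 and every ζ ∈ ℝ^N one has ∫_{ℝ^N} (|η| + a)^{-(N+ε)} (|η − ζ| + b)^{-(N−δ)} dη ≤ c · a^{−ε} (|ζ| + a + b)^{−(N−δ)}. -/
open MeasureTheory ENNReal

section Scaling

variable {E : Type*} [NormedAddCommGroup E] [NormedSpace ℝ E] [FiniteDimensional ℝ E]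
  [MeasurableSpace E] [BorelSpace E] (μ : Measure E) [μ.IsAddHaarMeasure]

/-- Change of variables `x ↦ r • x` in a lower Lebesgue integral. -/
theorem lintegral_eq_ofReal_pow_mul_lintegral_comp_smul {r : ℝ} (hr : 0 < r)
    {f : E → ℝ≥0∞} (hf : Measurable f) :
    ∫⁻ x, f x ∂μ =
      ENNReal.ofReal (r ^ Module.finrank ℝ E) * ∫⁻ x, f (r • x) ∂μ := by
  rw [← lintegral_map hf (measurable_const_smul r), Measure.map_addHaar_smul μ hr.ne',
    lintegral_smul_measure, smul_eq_mul, ← mul_assoc, ← ENNReal.ofReal_mul (by positivity),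
    abs_of_pos (by positivity), mul_inv_cancel₀ (by positivity), ENNReal.ofReal_one, one_mul]

theorem lintegral_norm_add_rpow_neg {a : ℝ} (ha : 0 < a) (s : ℝ) :
    ∫⁻ x, ENNReal.ofReal ((‖x‖ + a) ^ (-s)) ∂μ =
      ENNReal.ofReal (a ^ ((Module.finrank ℝ E : ℝ) - s)) *
        ∫⁻ x, ENNReal.ofReal ((1 + ‖x‖) ^ (-s)) ∂μ := by
  rw [lintegral_eq_ofReal_pow_mul_lintegral_comp_smul μ ha (by fun_prop)]
  have h : ∀ x : E, ENNReal.ofReal ((‖a • x‖ + a) ^ (-s)) =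
      ENNReal.ofReal (a ^ (-s)) * ENNReal.ofReal ((1 + ‖x‖) ^ (-s)) := fun x ↦ by
    rw [← ENNReal.ofReal_mul (by positivity), ← Real.mul_rpow ha.le (by positivity),
      norm_smul, Real.norm_of_nonneg ha.le]
    congr 2
    ring
  simp_rw [h]
  rw [lintegral_const_mul _ (by fun_prop), ← mul_assoc, ← ENNReal.ofReal_mul (by positivity),
    ← Real.rpow_natCast, ← Real.rpow_add ha, sub_eq_add_neg]

theorem setLIntegral_ball_norm_rpow_neg {r : ℝ} (hr : 0 < r) (p : ℝ) :
    ∫⁻ x in Metric.ball (0 : E) r, ENNReal.ofReal (‖x‖ ^ (-p)) ∂μ =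
      ENNReal.ofReal (r ^ ((Module.finrank ℝ E : ℝ) - p)) *
        ∫⁻ x in Metric.ball (0 : E) 1, ENNReal.ofReal (‖x‖ ^ (-p)) ∂μ := by
  rw [← lintegral_indicator measurableSet_ball, ← lintegral_indicator measurableSet_ball]
  have hm : Measurable fun x : E ↦ ENNReal.ofReal (‖x‖ ^ (-p)) := by fun_prop
  rw [lintegral_eq_ofReal_pow_mul_lintegral_comp_smul μ hr (hm.indicator measurableSet_ball)]
  have h : ∀ x : E, (Metric.ball (0 : E) r).indicator
        (fun x ↦ ENNReal.ofReal (‖x‖ ^ (-p))) (r • x) =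
      ENNReal.ofReal (r ^ (-p)) * (Metric.ball (0 : E) 1).indicator
        (fun x ↦ ENNReal.ofReal (‖x‖ ^ (-p))) x := fun x ↦ by
    have hx : r • x ∈ Metric.ball (0 : E) r ↔ x ∈ Metric.ball (0 : E) 1 := by
      rw [mem_ball_zero_iff, mem_ball_zero_iff, norm_smul, Real.norm_of_nonneg hr.le,
        mul_lt_iff_lt_one_right hr]
    by_cases hx1 : x ∈ Metric.ball (0 : E) 1
    · rw [Set.indicator_of_mem hx1, Set.indicator_of_mem (hx.2 hx1),
        ← ENNReal.ofReal_mul (by positivity), ← Real.mul_rpow hr.le (by positivity),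
        norm_smul, Real.norm_of_nonneg hr.le]
    · rw [Set.indicator_of_notMem hx1, Set.indicator_of_notMem (mt hx.1 hx1), mul_zero]
  simp_rw [h]
  rw [lintegral_const_mul _ (hm.indicator measurableSet_ball), ← mul_assoc,
    ← ENNReal.ofReal_mul (by positivity),
    ← Real.rpow_natCast, ← Real.rpow_add hr, sub_eq_add_neg]

theorem setLIntegral_ball_norm_rpow_neg_lt_top (hE : 1 ≤ Module.finrank ℝ E) {p : ℝ}
    (hp : p < Module.finrank ℝ E) (r : ℝ) :
    ∫⁻ x in Metric.ball (0 : E) r, ENNReal.ofReal (‖x‖ ^ (-p)) ∂μ < ∞ := by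
  have hm : Measurable fun x : E ↦ ‖x‖ ^ (-p) := by fun_prop
  exact (integrableOn_ball_of_norm_le_rpow (μ := μ) hE (C := 1) hp
    (Filter.Eventually.of_forall fun x ↦ by
      rw [one_mul, Real.norm_of_nonneg (by positivity)]) hm.aestronglyMeasurable).setLIntegral_lt_top

end Scaling

/-- With `R = ‖z‖ + a + b`, one of the two factors of the kernel is always controlled by a power
of `R`: the second one away from `z`, the first one close to `z`. -/
theorem kernel_mul_le_add_indicator {E : Type*} [NormedAddCommGroup E] {s p a b : ℝ} (hs : 0 < s)
    (hp : 0 < p) (ha : 0 < a) (hb : 0 ≤ b) {x z : E} (hxz : x ≠ z) :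
    ENNReal.ofReal ((‖x‖ + a) ^ (-s) * (‖x - z‖ + b) ^ (-p)) ≤
      ENNReal.ofReal (((‖z‖ + a + b) / 2) ^ (-p)) * ENNReal.ofReal ((‖x‖ + a) ^ (-s)) +
      ENNReal.ofReal (((‖z‖ + a + b) / 2) ^ (-s)) *
        (Metric.ball (0 : E) ((‖z‖ + a + b) / 2)).indicator
          (fun y ↦ ENNReal.ofReal (‖y‖ ^ (-p))) (x - z) := by
  have hR : 0 < (‖z‖ + a + b) / 2 := by positivity
  have hpos : 0 < ‖x - z‖ := norm_pos_iff.2 (sub_ne_zero.2 hxz)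
  rcases le_or_gt ((‖z‖ + a + b) / 2) (‖x - z‖ + b) with h | h
  · refine le_add_right ?_
    rw [← ENNReal.ofReal_mul (by positivity), mul_comm]
    exact ENNReal.ofReal_le_ofReal (mul_le_mul_of_nonneg_right
      (Real.rpow_le_rpow_of_nonpos hR h (by linarith)) (by positivity))
  · refine le_add_left ?_
    have hz : ‖z‖ ≤ ‖x‖ + ‖x - z‖ := by
      simpa [norm_sub_rev] using norm_sub_le x (x - z)
    rw [Set.indicator_of_mem (mem_ball_zero_iff.2 (by linarith)),
      ← ENNReal.ofReal_mul (by positivity)]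
    exact ENNReal.ofReal_le_ofReal (mul_le_mul
      (Real.rpow_le_rpow_of_nonpos hR (by linarith) (by linarith))
      (Real.rpow_le_rpow_of_nonpos hpos (by linarith) (by linarith))
      (by positivity) (by positivity))

/-- Let `N` be a positive integer, `ε > 0`, `0 < δ < N`. Then there is a
constant `c = c(N, ε, δ) > 0` such that for every `a > 0`, `b ≥ 0` and `ζ ∈ ℝ^N`,
`∫_{ℝ^N} (|η|+a)^{-(N+ε)} (|η-ζ|+b)^{-(N-δ)} dη ≤ c · a^{-ε} (|ζ|+a+b)^{-(N-δ)}`. -/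
theorem stmt_0 (N : ℕ) (hN : 0 < N) (ε δ : ℝ) (hε : 0 < ε) (hδ0 : 0 < δ) (hδN : δ < N) :
    ∃ c : ℝ, 0 < c ∧
      ∀ (a b : ℝ), 0 < a → 0 ≤ b → ∀ ζ : EuclideanSpace ℝ (Fin N),
        (∫⁻ η : EuclideanSpace ℝ (Fin N),
            ENNReal.ofReal
              ((‖η‖ + a) ^ (-((N : ℝ) + ε)) * (‖η - ζ‖ + b) ^ (-((N : ℝ) - δ))))
          ≤ ENNReal.ofReal (c * a ^ (-ε) * (‖ζ‖ + a + b) ^ (-((N : ℝ) - δ))) := by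
  have : Nonempty (Fin N) := ⟨⟨0, hN⟩⟩
  have hdim : Module.finrank ℝ (EuclideanSpace ℝ (Fin N)) = N := finrank_euclideanSpace_fin
  obtain ⟨A, hA0, hA⟩ : ∃ A : ℝ, 0 ≤ A ∧ ∫⁻ x : EuclideanSpace ℝ (Fin N),
      ENNReal.ofReal ((1 + ‖x‖) ^ (-((N : ℝ) + ε))) = ENNReal.ofReal A :=
    ⟨_, ENNReal.toReal_nonneg, (ENNReal.ofReal_toReal (finite_integral_one_add_norm
      (by rw [hdim]; linarith)).ne).symm⟩
  obtain ⟨B, hB0, hB⟩ : ∃ B : ℝ, 0 ≤ B ∧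
      ∫⁻ x in Metric.ball (0 : EuclideanSpace ℝ (Fin N)) 1,
        ENNReal.ofReal (‖x‖ ^ (-((N : ℝ) - δ))) = ENNReal.ofReal B :=
    ⟨_, ENNReal.toReal_nonneg, (ENNReal.ofReal_toReal (setLIntegral_ball_norm_rpow_neg_lt_top
      volume (by rw [hdim]; exact hN) (by rw [hdim]; linarith) 1).ne).symm⟩
  refine ⟨2 ^ ((N : ℝ) - δ) * (A + 2 ^ ε * B) + 1, by positivity, fun a b ha hb ζ ↦ ?_⟩
  set p : ℝ := (N : ℝ) - δ with hp_def
  set s : ℝ := (N : ℝ) + ε with hs_def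
  set R : ℝ := ‖ζ‖ + a + b with hR_def
  have hR : 0 < R := by positivity
  have haR : a ≤ R := by linarith [norm_nonneg ζ]
  have hm : Measurable ((Metric.ball (0 : EuclideanSpace ℝ (Fin N)) (R / 2)).indicator
      fun y ↦ ENNReal.ofReal (‖y‖ ^ (-p))) :=
    Measurable.indicator (by fun_prop) measurableSet_ball
  have hsplit : (R / 2) ^ (-p) = 2 ^ p * R ^ (-p) := by
    rw [Real.div_rpow hR.le zero_le_two, Real.rpow_neg zero_le_two, div_inv_eq_mul, mul_comm]
  have hRε : (R / 2) ^ (-ε) ≤ 2 ^ ε * a ^ (-ε) := by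
    rw [Real.div_rpow hR.le zero_le_two, Real.rpow_neg zero_le_two, div_inv_eq_mul, mul_comm]
    exact mul_le_mul_of_nonneg_left (Real.rpow_le_rpow_of_nonpos ha haR (by linarith))
      (by positivity)
  calc _ ≤ ∫⁻ η : EuclideanSpace ℝ (Fin N),
        (ENNReal.ofReal ((R / 2) ^ (-p)) * ENNReal.ofReal ((‖η‖ + a) ^ (-s)) +
          ENNReal.ofReal ((R / 2) ^ (-s)) * (Metric.ball 0 (R / 2)).indicator
            (fun y ↦ ENNReal.ofReal (‖y‖ ^ (-p))) (η - ζ)) := by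
        refine lintegral_mono_ae ?_
        filter_upwards [Measure.ae_ne volume ζ] with η hη
        exact kernel_mul_le_add_indicator (by positivity) (by linarith) ha hb hη
    _ = ENNReal.ofReal ((R / 2) ^ (-p) * (a ^ (-ε) * A) +
          (R / 2) ^ (-s) * ((R / 2) ^ δ * B)) := by
        rw [lintegral_add_left (by fun_prop), lintegral_const_mul _ (by fun_prop),
          lintegral_const_mul _ (by exact hm.comp (measurable_id.sub_const ζ)),
          lintegral_norm_add_rpow_neg _ ha, hA, lintegral_sub_right_eq_self
            ((Metric.ball 0 (R / 2)).indicator fun y ↦ ENNReal.ofReal (‖y‖ ^ (-p))) ζ,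
          lintegral_indicator measurableSet_ball,
          setLIntegral_ball_norm_rpow_neg _ (by positivity), hB, hdim,
          show (N : ℝ) - s = -ε by rw [hs_def]; ring, show (N : ℝ) - p = δ by rw [hp_def]; ring,
          ← ENNReal.ofReal_mul (by positivity), ← ENNReal.ofReal_mul (by positivity),
          ← ENNReal.ofReal_mul (by positivity), ← ENNReal.ofReal_mul (by positivity),
          ← ENNReal.ofReal_add (by positivity) (by positivity)]
    _ ≤ _ := by
        refine ENNReal.ofReal_le_ofReal ?_
        have hexp : (R / 2) ^ (-s) * ((R / 2) ^ δ * B) = (R / 2) ^ (-p) * ((R / 2) ^ (-ε) * B) := by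
          rw [← mul_assoc, ← mul_assoc, ← Real.rpow_add (by positivity),
            ← Real.rpow_add (by positivity)]
          congr 2
          rw [hp_def, hs_def]
          ring
        calc _ ≤ (R / 2) ^ (-p) * (a ^ (-ε) * A) +
              (R / 2) ^ (-p) * ((2 ^ ε * a ^ (-ε)) * B) := by
              rw [hexp]
              gcongr
          _ = 2 ^ p * (A + 2 ^ ε * B) * (a ^ (-ε) * R ^ (-p)) := by
              rw [hsplit]
              ring
          _ ≤ (2 ^ p * (A + 2 ^ ε * B) + 1) * (a ^ (-ε) * R ^ (-p)) := by
              gcongr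
              linarith
          _ = _ := by ring
end

section
/- Let n ≥ 2, 1 < p < ∞ and a ∈ ℝ. Let 𝒬 be a nonnegative measurable function on {ζ = (ζ', ζ_n) ∈ ℝ^{n−1} × ℝ : ζ_n > −1} such that I := ∫_{ℝ^n_+} 𝒬(ζ', ζ_n − 1) ζ_n^{−a−1/p} dζ < ∞. For a nonnegative measurable function f on ℝ^n_+ define Qf(x) := x_n^{−n} ∫_{ℝ^n_+} 𝒬((y − x)/x_n) f(y) dy for x = (x', x_n) ∈ ℝ^n_+. Then (∫_{ℝ^n_+} (Qf(x))^p x_n^{ap} dx)^{1/p} ≤ I · (∫_{ℝ^n_+} f(x)^p x_n^{ap} dx)^{1/p} (as an inequality in the extended nonnegative reals). -/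
open MeasureTheory ENNReal

/-- The open upper half-space `ℝ^{d+1}_+ = {x : x_{d+1} > 0}`. -/
def upperHalfSpace (d : ℕ) : Set (EuclideanSpace ℝ (Fin (d + 1))) :=
  {x | 0 < x (Fin.last d)}

theorem measurableSet_upperHalfSpace (d : ℕ) : MeasurableSet (upperHalfSpace d) :=
  measurableSet_lt measurable_const (by fun_prop)

/-- Jensen's inequality for `t ↦ t ^ p` with a weight that need not have total mass one. -/
theorem rpow_lintegral_mul_le {α : Type*} [MeasurableSpace α] {μ : Measure α} {p : ℝ} (hp : 1 < p)
    {w g : α → ℝ≥0∞} (hw : Measurable w) (hg : Measurable g) :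
    (∫⁻ t, w t * g t ∂μ) ^ p ≤ (∫⁻ t, w t ∂μ) ^ (p - 1) * ∫⁻ t, w t * g t ^ p ∂μ := by
  have hp0 : 0 < p := by linarith
  have hpq : p.HolderConjugate (p / (p - 1)) := Real.HolderConjugate.conjExponent hp
  have key := ENNReal.lintegral_mul_le_Lp_mul_Lq (μ.withDensity w) hpq
    hg.aemeasurable (aemeasurable_const (b := (1 : ℝ≥0∞)))
  rw [lintegral_withDensity_eq_lintegral_mul _ hw (by fun_prop),
    lintegral_withDensity_eq_lintegral_mul _ hw (by fun_prop),
    lintegral_withDensity_eq_lintegral_mul _ hw (by fun_prop)] at key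
  simp only [Pi.mul_apply, mul_one, ENNReal.one_rpow] at key
  calc (∫⁻ t, w t * g t ∂μ) ^ p
      ≤ ((∫⁻ t, w t * g t ^ p ∂μ) ^ (1 / p) * (∫⁻ t, w t ∂μ) ^ (1 / (p / (p - 1)))) ^ p := by
        gcongr
    _ = (∫⁻ t, w t ∂μ) ^ (p - 1) * ∫⁻ t, w t * g t ^ p ∂μ := by
        rw [ENNReal.mul_rpow_of_nonneg _ _ hp0.le, ← ENNReal.rpow_mul, ← ENNReal.rpow_mul,
          one_div_mul_cancel hp0.ne', ENNReal.rpow_one, mul_comm]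
        congr 2
        field_simp

/-- The change of variables `y = x + x_n (ζ - e_n)` for fixed `x`. -/
theorem lintegral_upperHalfSpace_comp_smul_sub {d : ℕ} {x : EuclideanSpace ℝ (Fin (d + 1))}
    (hx : x ∈ upperHalfSpace d) (g : EuclideanSpace ℝ (Fin (d + 1)) → ℝ≥0∞) :
    ENNReal.ofReal ((x (Fin.last d)) ^ (-((d : ℝ) + 1))) * ∫⁻ y in upperHalfSpace d, g y =
      ∫⁻ ζ in upperHalfSpace d,
        g (x + x (Fin.last d) • (ζ - EuclideanSpace.single (Fin.last d) (1 : ℝ))) := by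
  have hx0 : 0 < x (Fin.last d) := hx
  set r := x (Fin.last d) with hr
  set e := EuclideanSpace.single (Fin.last d) (1 : ℝ)
  have he : e (Fin.last d) = 1 := by simp [e]
  have himage : (fun ζ => x + r • (ζ - e)) '' upperHalfSpace d = upperHalfSpace d := by
    ext y
    constructor
    · rintro ⟨ζ, hζ, rfl⟩
      have hζ0 : 0 < ζ (Fin.last d) := hζ
      have : r + r * (ζ (Fin.last d) - 1) = r * ζ (Fin.last d) := by ring
      simp only [upperHalfSpace, Set.mem_ofPred_eq, PiLp.add_apply, PiLp.smul_apply,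
        PiLp.sub_apply, he, smul_eq_mul, ← hr, this]
      positivity
    · intro hy
      have hy0 : 0 < y (Fin.last d) := hy
      refine ⟨e + r⁻¹ • (y - x), ?_, ?_⟩
      · have : 1 + r⁻¹ * (y (Fin.last d) - r) = r⁻¹ * y (Fin.last d) := by field_simp; ring
        simp only [upperHalfSpace, Set.mem_ofPred_eq, PiLp.add_apply, PiLp.smul_apply,
          PiLp.sub_apply, he, smul_eq_mul, ← hr, this]
        positivity
      · simp [smul_smul, hx0.ne']
  have hderiv : ∀ ζ ∈ upperHalfSpace d, HasFDerivWithinAt (fun ζ => x + r • (ζ - e))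
      (r • ContinuousLinearMap.id ℝ (EuclideanSpace ℝ (Fin (d + 1)))) (upperHalfSpace d) ζ :=
    fun ζ _ => ((((hasFDerivAt_id ζ).sub_const e).const_smul r).const_add x).hasFDerivWithinAt
  have hinj : Set.InjOn (fun ζ => x + r • (ζ - e)) (upperHalfSpace d) := by
    intro u _ v _ huv
    simpa [hx0.ne'] using huv
  have hdet : |(r • ContinuousLinearMap.id ℝ (EuclideanSpace ℝ (Fin (d + 1)))).det| =
      r ^ ((d : ℝ) + 1) := by
    have : (r • ContinuousLinearMap.id ℝ (EuclideanSpace ℝ (Fin (d + 1)))).det = r ^ (d + 1) := by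
      simp [ContinuousLinearMap.det]
    rw [this, abs_of_pos (by positivity), ← Real.rpow_natCast]
    push_cast
    rfl
  have hchange := lintegral_image_eq_lintegral_abs_det_fderiv_mul volume
    (measurableSet_upperHalfSpace d) hderiv hinj g
  rw [himage, hdet, lintegral_const_mul' _ _ ENNReal.ofReal_ne_top] at hchange
  rw [hchange, ← mul_assoc, ← ENNReal.ofReal_mul (by positivity), ← Real.rpow_add hx0]
  simp

/-- The change of variables `y = x + x_n (ζ - e_n)` for fixed `ζ`. -/
theorem lintegral_upperHalfSpace_comp_add_smul {d : ℕ} {ζ : EuclideanSpace ℝ (Fin (d + 1))}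
    (hζ : ζ ∈ upperHalfSpace d) (g : EuclideanSpace ℝ (Fin (d + 1)) → ℝ≥0∞) :
    ∫⁻ y in upperHalfSpace d, g y = ENNReal.ofReal (ζ (Fin.last d)) *
      ∫⁻ x in upperHalfSpace d,
        g (x + x (Fin.last d) • (ζ - EuclideanSpace.single (Fin.last d) (1 : ℝ))) := by
  have hs0 : 0 < ζ (Fin.last d) := hζ
  set s := ζ (Fin.last d) with hs
  set e := EuclideanSpace.single (Fin.last d) (1 : ℝ)
  have he : e (Fin.last d) = 1 := by simp [e]
  let φ : Module.Dual ℝ (EuclideanSpace ℝ (Fin (d + 1))) :=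
    (EuclideanSpace.proj (𝕜 := ℝ) (Fin.last d)).toLinearMap
  let A : EuclideanSpace ℝ (Fin (d + 1)) →L[ℝ] EuclideanSpace ℝ (Fin (d + 1)) :=
    LinearMap.toContinuousLinearMap (LinearMap.transvection φ (ζ - e))
  have hA : ∀ x, A x = x + x (Fin.last d) • (ζ - e) := fun x => rfl
  have hAlast : ∀ x, A x (Fin.last d) = x (Fin.last d) * s := by
    intro x
    simp only [hA, PiLp.add_apply, PiLp.smul_apply, PiLp.sub_apply, he, smul_eq_mul, ← hs]
    ring
  have hdet : A.det = s := by
    have : (LinearMap.transvection φ (ζ - e)).det = 1 + φ (ζ - e) := LinearMap.transvection.det _ _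
    have hφ : φ (ζ - e) = s - 1 := by
      change (ζ - e) (Fin.last d) = s - 1
      rw [PiLp.sub_apply, he]
    rw [hφ] at this
    change LinearMap.det (LinearMap.transvection φ (ζ - e)) = s
    rw [this]
    ring
  have himage : A '' upperHalfSpace d = upperHalfSpace d := by
    ext y
    constructor
    · rintro ⟨x, hx, rfl⟩
      have hx0 : 0 < x (Fin.last d) := hx
      change 0 < A x (Fin.last d)
      rw [hAlast]
      positivity
    · intro hy
      have hy0 : 0 < y (Fin.last d) := hy
      have hlast : (y - (y (Fin.last d) / s) • (ζ - e)) (Fin.last d) = y (Fin.last d) / s := by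
        simp only [PiLp.smul_apply, PiLp.sub_apply, he, smul_eq_mul, ← hs]
        field_simp
        ring
      refine ⟨y - (y (Fin.last d) / s) • (ζ - e), ?_, ?_⟩
      · change 0 < (y - (y (Fin.last d) / s) • (ζ - e)) (Fin.last d)
        rw [hlast]
        positivity
      · rw [hA, hlast]
        simp
  have hinj : Set.InjOn A (upperHalfSpace d) := by
    intro u _ v _ huv
    have h : u (Fin.last d) = v (Fin.last d) := by
      have := congrArg (fun z => z (Fin.last d)) huv
      simp only [hAlast] at this
      exact mul_right_cancel₀ hs0.ne' this
    rw [hA, hA, h] at huv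
    exact add_right_cancel huv
  have hchange := lintegral_image_eq_lintegral_abs_det_fderiv_mul volume
    (measurableSet_upperHalfSpace d) (fun x _ => A.hasFDerivWithinAt) hinj g
  rwa [himage, hdet, abs_of_pos hs0, lintegral_const_mul' _ _ ENNReal.ofReal_ne_top] at hchange

/-- For `1 < p < ∞`, `a ∈ ℝ`, and a nonnegative measurable `𝒬` with
`I := ∫_{ℝ^n_+} 𝒬(ζ', ζ_n - 1) ζ_n^{-a-1/p} dζ < ∞`, the operator
`Qf(x) = x_n^{-n} ∫_{ℝ^n_+} 𝒬((y-x)/x_n) f(y) dy` satisfies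
`‖Qf‖_{L_p(ℝ^n_+, x_n^{ap} dx)} ≤ I · ‖f‖_{L_p(ℝ^n_+, x_n^{ap} dx)}`
(as an inequality in the extended nonnegative reals). -/
theorem stmt_1 (d : ℕ) (hd : 1 ≤ d) (p a : ℝ) (hp : 1 < p)
    (Q : EuclideanSpace ℝ (Fin (d + 1)) → ℝ≥0∞) (hQ : Measurable Q)
    (hQfin :
      (∫⁻ ζ in upperHalfSpace d,
          Q (ζ - EuclideanSpace.single (Fin.last d) (1 : ℝ)) *
            ENNReal.ofReal ((ζ (Fin.last d)) ^ (-a - 1 / p))) < ⊤)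
    (f : EuclideanSpace ℝ (Fin (d + 1)) → ℝ≥0∞) (hf : Measurable f) :
    (∫⁻ x in upperHalfSpace d,
        (ENNReal.ofReal ((x (Fin.last d)) ^ (-((d : ℝ) + 1))) *
            ∫⁻ y in upperHalfSpace d, Q ((x (Fin.last d))⁻¹ • (y - x)) * f y) ^ p *
          ENNReal.ofReal ((x (Fin.last d)) ^ (a * p))) ^ (1 / p)
      ≤ (∫⁻ ζ in upperHalfSpace d,
            Q (ζ - EuclideanSpace.single (Fin.last d) (1 : ℝ)) *
              ENNReal.ofReal ((ζ (Fin.last d)) ^ (-a - 1 / p))) *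
          (∫⁻ x in upperHalfSpace d,
              (f x) ^ p * ENNReal.ofReal ((x (Fin.last d)) ^ (a * p))) ^ (1 / p) := by
  have hp0 : 0 < p := by linarith
  have hH := measurableSet_upperHalfSpace d
  set e := EuclideanSpace.single (Fin.last d) (1 : ℝ)
  have he : e (Fin.last d) = 1 := by simp [e]
  set w : EuclideanSpace ℝ (Fin (d + 1)) → ℝ≥0∞ := fun ζ =>
    Q (ζ - e) * ENNReal.ofReal ((ζ (Fin.last d)) ^ (-a - 1 / p)) with hw
  have hwm : Measurable w := by fun_prop
  set I := ∫⁻ ζ in upperHalfSpace d, w ζ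
  set F := ∫⁻ x in upperHalfSpace d, (f x) ^ p * ENNReal.ofReal ((x (Fin.last d)) ^ (a * p))
  have hpointwise : ∀ x ∈ upperHalfSpace d,
      (ENNReal.ofReal ((x (Fin.last d)) ^ (-((d : ℝ) + 1))) *
        ∫⁻ y in upperHalfSpace d, Q ((x (Fin.last d))⁻¹ • (y - x)) * f y) ^ p *
          ENNReal.ofReal ((x (Fin.last d)) ^ (a * p)) ≤
      I ^ (p - 1) * ∫⁻ ζ in upperHalfSpace d,
        w ζ * (ENNReal.ofReal ((ζ (Fin.last d)) ^ (a + 1 / p)) *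
          f (x + x (Fin.last d) • (ζ - e))) ^ p *
            ENNReal.ofReal ((x (Fin.last d)) ^ (a * p)) := by
    intro x hx
    have hx0 : 0 < x (Fin.last d) := hx
    have heq : ENNReal.ofReal ((x (Fin.last d)) ^ (-((d : ℝ) + 1))) *
        ∫⁻ y in upperHalfSpace d, Q ((x (Fin.last d))⁻¹ • (y - x)) * f y =
        ∫⁻ ζ in upperHalfSpace d, w ζ * (ENNReal.ofReal ((ζ (Fin.last d)) ^ (a + 1 / p)) *
          f (x + x (Fin.last d) • (ζ - e))) := by
      rw [lintegral_upperHalfSpace_comp_smul_sub hx]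
      refine setLIntegral_congr_fun hH fun ζ hζ => ?_
      have hζ0 : 0 < ζ (Fin.last d) := hζ
      have hone : ENNReal.ofReal ((ζ (Fin.last d)) ^ (-a - 1 / p)) *
          ENNReal.ofReal ((ζ (Fin.last d)) ^ (a + 1 / p)) = 1 := by
        rw [← ENNReal.ofReal_mul (by positivity), ← Real.rpow_add hζ0]
        ring_nf
        simp
      simp only [add_sub_cancel_left, smul_smul, inv_mul_cancel₀ hx0.ne', one_smul, hw]
      rw [mul_assoc, ← mul_assoc (ENNReal.ofReal _), hone, one_mul]
    rw [heq, lintegral_mul_const' _ _ ENNReal.ofReal_ne_top, ← mul_assoc]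
    gcongr
    exact rpow_lintegral_mul_le hp hwm (by fun_prop)
  have hinner : ∀ ζ ∈ upperHalfSpace d,
      ∫⁻ x in upperHalfSpace d, w ζ * (ENNReal.ofReal ((ζ (Fin.last d)) ^ (a + 1 / p)) *
          f (x + x (Fin.last d) • (ζ - e))) ^ p *
            ENNReal.ofReal ((x (Fin.last d)) ^ (a * p)) = w ζ * F := by
    intro ζ hζ
    have hζ0 : 0 < ζ (Fin.last d) := hζ
    have hF := lintegral_upperHalfSpace_comp_add_smul hζ
      (fun x => (f x) ^ p * ENNReal.ofReal ((x (Fin.last d)) ^ (a * p)))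
    rw [show F = _ from hF, ← lintegral_const_mul' _ _ ENNReal.ofReal_ne_top,
      ← lintegral_const_mul _ (by fun_prop)]
    refine setLIntegral_congr_fun hH fun x hx => ?_
    have hx0 : 0 < x (Fin.last d) := hx
    have hlast : (x + x (Fin.last d) • (ζ - e)) (Fin.last d) =
        x (Fin.last d) * ζ (Fin.last d) := by
      simp only [PiLp.add_apply, PiLp.smul_apply, PiLp.sub_apply, he, smul_eq_mul]
      ring
    have hpow : ENNReal.ofReal ((ζ (Fin.last d)) ^ (a + 1 / p)) ^ p =
        ENNReal.ofReal (ζ (Fin.last d)) * ENNReal.ofReal ((ζ (Fin.last d)) ^ (a * p)) := by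
      have hexp : (a + 1 / p) * p = 1 + a * p := by field_simp; ring
      rw [ENNReal.ofReal_rpow_of_nonneg (by positivity) hp0.le, ← Real.rpow_mul hζ0.le,
        ← ENNReal.ofReal_mul hζ0.le, hexp, Real.rpow_add hζ0, Real.rpow_one]
    change _ = w ζ * (ENNReal.ofReal (ζ (Fin.last d)) *
      (f (x + x (Fin.last d) • (ζ - e)) ^ p *
        ENNReal.ofReal ((x + x (Fin.last d) • (ζ - e)) (Fin.last d) ^ (a * p))))
    rw [hlast, Real.mul_rpow hx0.le hζ0.le, ENNReal.ofReal_mul (by positivity),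
      ENNReal.mul_rpow_of_nonneg _ _ hp0.le, hpow]
    ring
  calc _ ≤ (∫⁻ x in upperHalfSpace d, I ^ (p - 1) * ∫⁻ ζ in upperHalfSpace d,
        w ζ * (ENNReal.ofReal ((ζ (Fin.last d)) ^ (a + 1 / p)) *
          f (x + x (Fin.last d) • (ζ - e))) ^ p *
            ENNReal.ofReal ((x (Fin.last d)) ^ (a * p))) ^ (1 / p) := by
        gcongr ?_ ^ (1 / p)
        exact setLIntegral_mono' hH hpointwise
    _ = (I ^ (p - 1) * (I * F)) ^ (1 / p) := by
        rw [lintegral_const_mul' _ _ (ENNReal.rpow_ne_top_of_nonneg (by linarith) hQfin.ne),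
          lintegral_lintegral_swap (by fun_prop), setLIntegral_congr_fun hH hinner,
          lintegral_mul_const _ hwm]
    _ = I * F ^ (1 / p) := by
        have hI : I ^ (p - 1) * I = I ^ p := by
          nth_rewrite 2 [← ENNReal.rpow_one I]
          rw [← ENNReal.rpow_add_of_nonneg _ _ (by linarith) zero_le_one, sub_add_cancel]
        rw [← mul_assoc, hI, ENNReal.mul_rpow_of_nonneg _ _ (by positivity), ← ENNReal.rpow_mul,
          mul_one_div_cancel hp0.ne', ENNReal.rpow_one]
end

section
/- Let n ≥ 1 and m ∈ ℕ. There exists a constant c = c(m, n) > 0 such that for every p ∈ (1, ∞), every a ∈ (−1/p, 1 − 1/p), setting s := 1 − a − 1/p, and every u ∈ C_0^∞(ℝ^n_+), one has (Σ_{0 ≤ |β| ≤ m} ∫_{ℝ^n_+} |x_n^{|β| − m} D^β u(x)|^p x_n^{pa} dx)^{1/p} ≤ (c/s) (Σ_{|β| = m} ∫_{ℝ^n_+} |D^β u(x)|^p x_n^{pa} dx)^{1/p}. -/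
open MeasureTheory ENNReal NNReal

theorem lintegral_Ioc_zero_rpow {σ t : ℝ} (hσ : 0 < σ) (ht : 0 < t) :
    ∫⁻ s in Set.Ioc 0 t, ENNReal.ofReal (s ^ (σ - 1)) = ENNReal.ofReal (t ^ σ / σ) := by
  have hint : IntegrableOn (fun s : ℝ => s ^ (σ - 1)) (Set.Ioc 0 t) :=
    (intervalIntegrable_iff_integrableOn_Ioc_of_le ht.le).1
      (intervalIntegral.intervalIntegrable_rpow' (by linarith))
  rw [← ofReal_integral_eq_lintegral_ofReal hint, ← intervalIntegral.integral_of_le ht.le,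
    integral_rpow (Or.inl (by linarith))]
  · simp [hσ.ne']
  · filter_upwards [ae_restrict_mem measurableSet_Ioc] with s hs
    exact Real.rpow_nonneg hs.1.le _

theorem lintegral_Ioi_rpow {σ s : ℝ} (hσ : 0 < σ) (hs : 0 < s) :
    ∫⁻ t in Set.Ioi s, ENNReal.ofReal (t ^ (-1 - σ)) = ENNReal.ofReal (s ^ (-σ) / σ) := by
  rw [← ofReal_integral_eq_lintegral_ofReal
    (integrableOn_Ioi_rpow_of_lt (by linarith) hs), integral_Ioi_rpow_of_lt (by linarith) hs]
  · rw [show -1 - σ + 1 = -σ by ring, neg_div_neg_eq]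
  · filter_upwards [ae_restrict_mem measurableSet_Ioi] with t ht
    exact Real.rpow_nonneg (hs.trans ht).le _

theorem rpow_lintegral_Ioc_le {p σ t : ℝ} (hp : 1 < p) (hσ : 0 < σ) (ht : 0 < t) {h : ℝ → ℝ≥0∞}
    (hh : Measurable h) :
    (∫⁻ s in Set.Ioc 0 t, h s) ^ p ≤
      ENNReal.ofReal ((t ^ σ / σ) ^ (p - 1)) *
        ∫⁻ s in Set.Ioc 0 t, ENNReal.ofReal (s ^ ((p - 1) * (1 - σ))) * h s ^ p := by
  have hpq := Real.HolderConjugate.conjExponent hp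
  set q := Real.conjExponent p with hq
  have hp0 : 0 < p := by linarith
  have hp1 : p - 1 ≠ 0 := by linarith
  have hq0 : 0 < q := hpq.symm.pos
  set γ := (1 - σ) / q with hγ
  have hholder := ENNReal.lintegral_mul_le_Lp_mul_Lq (volume.restrict (Set.Ioc 0 t)) hpq
    (f := fun s => ENNReal.ofReal (s ^ γ) * h s) (g := fun s => ENNReal.ofReal (s ^ (-γ)))
    (by fun_prop) (by fun_prop)
  have h1 : ∫⁻ s in Set.Ioc 0 t, h s = ∫⁻ s in Set.Ioc 0 t,
      ((fun s => ENNReal.ofReal (s ^ γ) * h s) * fun s => ENNReal.ofReal (s ^ (-γ))) s := by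
    refine setLIntegral_congr_fun measurableSet_Ioc fun s hs => ?_
    have : ENNReal.ofReal (s ^ γ) * ENNReal.ofReal (s ^ (-γ)) = 1 := by
      rw [← ENNReal.ofReal_mul (Real.rpow_nonneg hs.1.le _), ← Real.rpow_add hs.1]
      simp
    simp only [Pi.mul_apply]
    rw [mul_right_comm, this, one_mul]
  have h2 : ∫⁻ s in Set.Ioc 0 t, ENNReal.ofReal (s ^ (-γ)) ^ q = ENNReal.ofReal (t ^ σ / σ) := by
    rw [← lintegral_Ioc_zero_rpow hσ ht]
    refine setLIntegral_congr_fun measurableSet_Ioc fun s hs => ?_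
    rw [ENNReal.ofReal_rpow_of_nonneg (Real.rpow_nonneg hs.1.le _) hq0.le,
      ← Real.rpow_mul hs.1.le, hγ]
    congr 2
    field_simp
    ring
  have h3 : ∫⁻ s in Set.Ioc 0 t, (ENNReal.ofReal (s ^ γ) * h s) ^ p =
      ∫⁻ s in Set.Ioc 0 t, ENNReal.ofReal (s ^ ((p - 1) * (1 - σ))) * h s ^ p := by
    refine setLIntegral_congr_fun measurableSet_Ioc fun s hs => ?_
    rw [ENNReal.mul_rpow_of_nonneg _ _ hp0.le,
      ENNReal.ofReal_rpow_of_nonneg (Real.rpow_nonneg hs.1.le _) hp0.le,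
      ← Real.rpow_mul hs.1.le, hγ, hq, Real.conjExponent]
    congr 3
    field_simp
  rw [← h1, h2, h3] at hholder
  calc _ ≤ _ := ENNReal.rpow_le_rpow hholder hp0.le
    _ = _ := by
      rw [ENNReal.mul_rpow_of_nonneg _ _ hp0.le, ← ENNReal.rpow_mul, ← ENNReal.rpow_mul,
        one_div_mul_cancel hp0.ne', ENNReal.rpow_one, mul_comm,
        show 1 / q * p = p - 1 by rw [hq, Real.conjExponent]; field_simp,
        ENNReal.ofReal_rpow_of_nonneg (by positivity) (by linarith)]

/-- The weighted one-dimensional Hardy inequality. -/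
theorem lintegral_hardy {p b σ : ℝ} (hp : 1 < p) (hσ : 0 < σ) (hb : σ = 1 - b - 1 / p)
    {h : ℝ → ℝ≥0∞} (hh : Measurable h) :
    ∫⁻ t in Set.Ioi 0, ENNReal.ofReal (t ^ (p * (b - 1))) * (∫⁻ s in Set.Ioc 0 t, h s) ^ p ≤
      ENNReal.ofReal (σ⁻¹ ^ p) * ∫⁻ s in Set.Ioi 0, ENNReal.ofReal (s ^ (p * b)) * h s ^ p := by
  have hp0 : 0 < p := by linarith
  have hpb : p * b = p - 1 - p * σ := by rw [hb]; field_simp; ring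
  set k : ℝ → ℝ≥0∞ := fun s => ENNReal.ofReal (s ^ ((p - 1) * (1 - σ))) * h s ^ p with hk
  have hkm : Measurable k := by fun_prop
  calc _ ≤ ∫⁻ t in Set.Ioi (0 : ℝ), ENNReal.ofReal (σ⁻¹ ^ (p - 1)) *
          (ENNReal.ofReal (t ^ (-1 - σ)) * ∫⁻ s in Set.Ioc 0 t, k s) := by
        refine setLIntegral_mono' measurableSet_Ioi fun t (ht : 0 < t) => ?_
        refine (mul_le_mul_right (rpow_lintegral_Ioc_le hp hσ ht hh) _).trans_eq ?_
        rw [← mul_assoc, ← mul_assoc, ← ENNReal.ofReal_mul (by positivity),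
          ← ENNReal.ofReal_mul (by positivity)]
        congr 2
        rw [div_eq_mul_inv, Real.mul_rpow (by positivity) (by positivity), ← mul_assoc,
          ← Real.rpow_mul ht.le, ← Real.rpow_add ht, mul_comm]
        congr 2
        linear_combination hpb
    _ = ENNReal.ofReal (σ⁻¹ ^ (p - 1)) * ∫⁻ t in Set.Ioi (0 : ℝ), ∫⁻ s in Set.Ioi (0 : ℝ),
          (Set.Ici s).indicator (fun t => ENNReal.ofReal (t ^ (-1 - σ))) t * k s := by
        rw [lintegral_const_mul' _ _ ENNReal.ofReal_ne_top]
        congr 1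
        refine setLIntegral_congr_fun measurableSet_Ioi fun t ht => ?_
        rw [← lintegral_const_mul _ hkm, ← lintegral_indicator measurableSet_Ioc,
          ← lintegral_indicator measurableSet_Ioi]
        congr 1 with s
        by_cases h1 : 0 < s <;> by_cases h2 : s ≤ t <;> simp [Set.indicator, h1, h2]
    _ = ENNReal.ofReal (σ⁻¹ ^ (p - 1)) * ∫⁻ s in Set.Ioi (0 : ℝ), ∫⁻ t in Set.Ioi (0 : ℝ),
          (Set.Ici s).indicator (fun t => ENNReal.ofReal (t ^ (-1 - σ))) t * k s := by
        rw [lintegral_lintegral_swap]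
        refine Measurable.aemeasurable ?_
        refine Measurable.mul ?_ (hkm.comp measurable_snd)
        exact Measurable.indicator (s := {z : ℝ × ℝ | z.2 ≤ z.1}) (by fun_prop)
          (measurableSet_le measurable_snd measurable_fst)
    _ = ENNReal.ofReal (σ⁻¹ ^ (p - 1)) * ∫⁻ s in Set.Ioi (0 : ℝ), ENNReal.ofReal σ⁻¹ *
          (ENNReal.ofReal (s ^ (p * b)) * h s ^ p) := by
        congr 1
        refine setLIntegral_congr_fun measurableSet_Ioi fun s (hs : 0 < s) => ?_
        rw [lintegral_mul_const _ (by measurability), setLIntegral_indicator measurableSet_Ici,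
          Set.inter_eq_left.2 (Set.Ici_subset_Ioi.2 hs), setLIntegral_congr Ioi_ae_eq_Ici.symm,
          lintegral_Ioi_rpow hσ hs, hk]
        simp only
        rw [← mul_assoc, ← mul_assoc, ← ENNReal.ofReal_mul (by positivity),
          ← ENNReal.ofReal_mul (by positivity), div_mul_eq_mul_div, ← Real.rpow_add hs,
          div_eq_inv_mul, hpb]
        congr 4
        ring
    _ = _ := by
        rw [lintegral_const_mul' _ _ ENNReal.ofReal_ne_top, ← mul_assoc,
          ← ENNReal.ofReal_mul (by positivity)]
        congr 2
        nth_rewrite 2 [← Real.rpow_one σ⁻¹]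
        rw [← Real.rpow_add (by positivity), sub_add_cancel]

theorem lintegral_upperHalfSpace (d : ℕ) {F : EuclideanSpace ℝ (Fin (d + 1)) → ℝ≥0∞}
    (hF : Measurable F) :
    ∫⁻ x in upperHalfSpace d, F x =
      ∫⁻ y : Fin d → ℝ, ∫⁻ t in Set.Ioi (0 : ℝ), F (WithLp.toLp 2 ((Fin.last d).insertNth t y)) := by
  have hS : MeasurableSet (upperHalfSpace d) :=
    measurableSet_lt measurable_const (by fun_prop)
  have hm := (PiLp.volume_preserving_toLp (Fin (d + 1))).comp
    (volume_preserving_piFinSuccAbove (fun _ => ℝ) (Fin.last d)).symm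
  have hG := hF.indicator hS
  rw [← lintegral_indicator hS, ← hm.lintegral_comp hG, Measure.volume_eq_prod]
  refine (lintegral_prod_symm _ (hG.comp hm.measurable).aemeasurable).trans ?_
  refine lintegral_congr fun y => ?_
  rw [← lintegral_indicator measurableSet_Ioi]
  refine lintegral_congr fun t => ?_
  simp [Set.indicator, upperHalfSpace, MeasurableEquiv.piFinSuccAbove, Fin.snocEquiv]

theorem hardy_upperHalfSpace {d : ℕ} {V : Type*} [NormedAddCommGroup V] [NormedSpace ℝ V]
    {p b σ : ℝ} (hp : 1 < p) (hσ : 0 < σ) (hb : σ = 1 - b - 1 / p)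
    {g : EuclideanSpace ℝ (Fin (d + 1)) → V} (hg : ContDiff ℝ 1 g)
    (hg0 : ∀ x, x (Fin.last d) = 0 → g x = 0) :
    ∫⁻ x in upperHalfSpace d, ENNReal.ofReal (x (Fin.last d) ^ (p * (b - 1))) * ‖g x‖ₑ ^ p ≤
      ENNReal.ofReal (σ⁻¹ ^ p) * ∫⁻ x in upperHalfSpace d,
        ENNReal.ofReal (x (Fin.last d) ^ (p * b)) * ‖fderiv ℝ g x‖ₑ ^ p := by
  have hg' := hg.continuous_fderiv one_ne_zero
  have hm1 : Measurable fun x => ‖g x‖ₑ := hg.continuous.enorm.measurable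
  have hm2 : Measurable fun x => ‖fderiv ℝ g x‖ₑ := hg'.enorm.measurable
  rw [lintegral_upperHalfSpace d (by fun_prop), lintegral_upperHalfSpace d (by fun_prop),
    ← lintegral_const_mul' _ _ ENNReal.ofReal_ne_top]
  refine lintegral_mono fun y => ?_
  simp only [Fin.insertNth_apply_same]
  set γ : ℝ → EuclideanSpace ℝ (Fin (d + 1)) :=
    fun t => WithLp.toLp 2 ((Fin.last d).insertNth t y) with hγ
  have hγ' : γ = fun t => γ 0 + t • EuclideanSpace.single (Fin.last d) (1 : ℝ) := by
    ext t i
    refine Fin.lastCases ?_ (fun i => ?_) i <;> simp [hγ]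
  have hγc : ContDiff ℝ 1 γ := by rw [hγ']; fun_prop
  have hγd : ∀ t, HasDerivAt γ (EuclideanSpace.single (Fin.last d) (1 : ℝ)) t := fun t => by
    rw [hγ']
    simpa using ((hasDerivAt_id t).smul_const
      (EuclideanSpace.single (Fin.last d) (1 : ℝ))).const_add (γ 0)
  have hbound : ∀ t, 0 < t → ‖g (γ t)‖ₑ ≤ ∫⁻ s in Set.Ioc 0 t, ‖fderiv ℝ g (γ s)‖ₑ := by
    intro t ht
    have h0 : g (γ 0) = 0 := hg0 _ (by simp [hγ])
    have h1 := enorm_sub_le_lintegral_deriv_of_contDiffOn_Icc (f := fun t => g (γ t))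
      (hg.comp hγc).contDiffOn ht.le
    rw [h0, sub_zero] at h1
    rw [setLIntegral_congr Ioc_ae_eq_Icc]
    refine h1.trans (lintegral_mono fun s => ?_)
    have hd : HasDerivAt (fun t => g (γ t))
        (fderiv ℝ g (γ s) (EuclideanSpace.single (Fin.last d) (1 : ℝ))) s :=
      ((hg.differentiable one_ne_zero).differentiableAt.hasFDerivAt).comp_hasDerivAt s (hγd s)
    rw [hd.deriv]
    refine (ContinuousLinearMap.le_opENorm _ _).trans_eq ?_
    simp [enorm_eq_nnnorm]
  refine le_trans ?_ (lintegral_hardy hp hσ hb (hm2.comp hγc.continuous.measurable))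
  refine setLIntegral_mono' measurableSet_Ioi fun t ht => ?_
  gcongr
  exact hbound t ht

theorem lintegral_iteratedFDeriv_le {d : ℕ} {p a s : ℝ} (hp : 1 < p) (hs : 0 < s) (hs1 : s ≤ 1)
    (hsa : s = 1 - a - 1 / p) {u : EuclideanSpace ℝ (Fin (d + 1)) → ℝ}
    (hu : ContDiff ℝ (⊤ : ℕ∞) u) (hsupp : tsupport u ⊆ upperHalfSpace d) (k j : ℕ) :
    ∫⁻ x in upperHalfSpace d,
        ENNReal.ofReal (x (Fin.last d) ^ (p * (a - k))) * ‖iteratedFDeriv ℝ j u x‖ₑ ^ p ≤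
      ENNReal.ofReal (s⁻¹ ^ p) * ∫⁻ x in upperHalfSpace d,
        ENNReal.ofReal (x (Fin.last d) ^ (p * a)) * ‖iteratedFDeriv ℝ (j + k) u x‖ₑ ^ p := by
  have hp0 : 0 < p := by linarith
  induction k generalizing j with
  | zero =>
    simp only [Nat.cast_zero, sub_zero]
    refine le_mul_of_one_le_left' ?_
    exact ENNReal.one_le_ofReal.2 (Real.one_le_rpow ((one_le_inv₀ hs).2 hs1) hp0.le)
  | succ k ih =>
    have hσ : 0 < s + k := by positivity
    have key := hardy_upperHalfSpace (b := a - k) (σ := s + k) hp hσ (by rw [hsa]; ring)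
      (g := iteratedFDeriv ℝ j u)
      (hu.iteratedFDeriv_right (by norm_cast; exact le_top))
      (fun x hx => by
        by_contra hne
        have hmem : 0 < x (Fin.last d) := hsupp (support_iteratedFDeriv_subset j hne)
        exact hmem.ne' hx)
    have henorm : ∀ x, ‖fderiv ℝ (iteratedFDeriv ℝ j u) x‖ₑ = ‖iteratedFDeriv ℝ (j + 1) u x‖ₑ :=
      fun x => by rw [← ofReal_norm, ← ofReal_norm, norm_fderiv_iteratedFDeriv]
    simp only [henorm, sub_sub] at key
    push_cast
    refine key.trans ?_
    rcases Nat.eq_zero_or_pos k with rfl | hk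
    · simp
    · have hk1 : (1 : ℝ) ≤ k := by exact_mod_cast hk
      have hle : ENNReal.ofReal ((s + k)⁻¹ ^ p) ≤ 1 :=
        ENNReal.ofReal_le_one.2
          (Real.rpow_le_one (by positivity) (inv_le_one_of_one_le₀ (by linarith)) hp0.le)
      refine (mul_le_of_le_one_left' hle).trans ((ih (j + 1)).trans_eq ?_)
      rw [add_right_comm, add_assoc j k 1]

/-- (Weighted Hardy inequality in the half-space.) There is a constant
`c = c(m, n) > 0` such that for all `1 < p < ∞`, `-1/p < a < 1 - 1/p`, `s = 1 - a - 1/p`,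
and all `u ∈ C_0^∞(ℝ^n_+)`,
`(Σ_{j ≤ m} ∫ (x_n^{j-m} |∇_j u|)^p x_n^{pa})^{1/p} ≤ (c/s)(∫ |∇_m u|^p x_n^{pa})^{1/p}`,
where `∇_j u` denotes the full derivative of order `j`. -/
theorem stmt_13 (d : ℕ) (m : ℕ) (hm : 1 ≤ m) :
    ∃ c : ℝ, 0 < c ∧
      ∀ (p a : ℝ), 1 < p → -(1 / p) < a → a < 1 - 1 / p →
        ∀ u : EuclideanSpace ℝ (Fin (d + 1)) → ℝ,
          ContDiff ℝ (⊤ : ℕ∞) u → HasCompactSupport u → tsupport u ⊆ upperHalfSpace d →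
          (∑ j ∈ Finset.range (m + 1),
              ∫⁻ x in upperHalfSpace d,
                ENNReal.ofReal
                  (((x (Fin.last d)) ^ ((j : ℝ) - m) * ‖iteratedFDeriv ℝ j u x‖) ^ p *
                    (x (Fin.last d)) ^ (p * a))) ^ (1 / p)
            ≤ ENNReal.ofReal (c / (1 - a - 1 / p)) *
                (∫⁻ x in upperHalfSpace d,
                    ENNReal.ofReal
                      (‖iteratedFDeriv ℝ m u x‖ ^ p * (x (Fin.last d)) ^ (p * a))) ^ (1 / p) := by
  refine ⟨m + 1, by positivity, fun p a hp ha1 ha2 u hu _ hsupp => ?_⟩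
  have hp0 : 0 < p := by linarith
  set s := 1 - a - 1 / p with hs_def
  have hs : 0 < s := by linarith
  have hs1 : s ≤ 1 := by linarith
  have hS : MeasurableSet (upperHalfSpace d) :=
    measurableSet_lt measurable_const (by fun_prop)
  have hleft : ∀ j ∈ Finset.range (m + 1),
      ∫⁻ x in upperHalfSpace d, ENNReal.ofReal
          (((x (Fin.last d)) ^ ((j : ℝ) - m) * ‖iteratedFDeriv ℝ j u x‖) ^ p *
            (x (Fin.last d)) ^ (p * a)) ≤
        ENNReal.ofReal (s⁻¹ ^ p) * ∫⁻ x in upperHalfSpace d,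
          ENNReal.ofReal (‖iteratedFDeriv ℝ m u x‖ ^ p * (x (Fin.last d)) ^ (p * a)) := by
    intro j hj
    have hjm : j ≤ m := Nat.lt_succ_iff.1 (Finset.mem_range.1 hj)
    convert! lintegral_iteratedFDeriv_le hp hs hs1 hs_def hu hsupp (m - j) j using 1
    · refine setLIntegral_congr_fun hS fun x (hx : 0 < x (Fin.last d)) => ?_
      rw [Real.mul_rpow (by positivity) (by positivity), mul_right_comm, ← Real.rpow_mul hx.le,
        ← Real.rpow_add hx, ENNReal.ofReal_mul (by positivity),
        ← ENNReal.ofReal_rpow_of_nonneg (norm_nonneg _) hp0.le, ofReal_norm, Nat.cast_sub hjm]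
      ring_nf
    · rw [Nat.add_sub_cancel' hjm]
      congr 1
      refine setLIntegral_congr_fun hS fun x (hx : 0 < x (Fin.last d)) => ?_
      rw [mul_comm, ENNReal.ofReal_mul (by positivity),
        ← ENNReal.ofReal_rpow_of_nonneg (norm_nonneg _) hp0.le, ofReal_norm]
  have hm1 : (1 : ℝ) ≤ m + 1 := by linarith [Nat.cast_nonneg (α := ℝ) m]
  set A := ∫⁻ x in upperHalfSpace d,
    ENNReal.ofReal (‖iteratedFDeriv ℝ m u x‖ ^ p * (x (Fin.last d)) ^ (p * a))
  have hconst : ((m + 1 : ℕ) : ℝ≥0∞) * ENNReal.ofReal (s⁻¹ ^ p) ≤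
      ENNReal.ofReal ((m + 1) / s) ^ p := by
    rw [ENNReal.ofReal_rpow_of_nonneg (by positivity) hp0.le, ← ENNReal.ofReal_natCast,
      ← ENNReal.ofReal_mul (by positivity), div_eq_mul_inv,
      Real.mul_rpow (by positivity) (by positivity), Nat.cast_add_one]
    gcongr
    exact Real.self_le_rpow_of_one_le hm1 hp.le
  calc _ ≤ (ENNReal.ofReal ((m + 1) / s) ^ p * A) ^ (1 / p) := by
        refine ENNReal.rpow_le_rpow ((Finset.sum_le_card_nsmul _ _ _ hleft).trans ?_)
          (by positivity)
        rw [Finset.card_range, nsmul_eq_mul, ← mul_assoc]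
        gcongr
    _ = _ := by
        rw [ENNReal.mul_rpow_of_nonneg _ _ (by positivity), ← ENNReal.rpow_mul,
          mul_one_div_cancel hp0.ne', ENNReal.rpow_one]
end

section
/- Let n ≥ 2, m ≥ 2, let φ : ℝ^{n−1} → ℝ be Lipschitz and define Φ : ℝ^{n−1} → ℝ^n by Φ(X') := (X', φ(X')). For each multi-index α ∈ ℕ₀^n with |α| ≤ m − 1 let g_α : ℝ^{n−1} → ℂ be Lipschitz, and assume that for every |α| ≤ m − 2 and every k ∈ {1, …, n − 1}, ∂g_α/∂X_k (X') = Σ_{j=1}^{n} g_{α + e_j}(X') ∂_k Φ_j(X') for almost every X' ∈ ℝ^{n−1}. Define R_α(X', Y') := g_α(X') − Σ_{|β| ≤ m−1−|α|} (1/β!) g_{α+β}(Y') (Φ(X') − Φ(Y'))^β. Then for every multi-index α with |α| ≤ m − 2, setting r := m − 1 − |α|, for almost every pair (X', Y') ∈ ℝ^{n−1} × ℝ^{n−1}: R_α(X', Y') = Σ_{(j_1, …, j_r) ∈ {1,…,n}^r} ∫_{Δ_r} [g_{α + e_{j_1} + ⋯ + e_{j_r}}(Y' + t_r (X' − Y'))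 − g_{α + e_{j_1} + ⋯ + e_{j_r}}(Y')] ∏_{k=1}^{r} (∇Φ_{j_k}(Y' + t_k (X' − Y')) · (X' − Y')) dt_r ⋯ dt_1, where Δ_r := {(t_1, …, t_r) : 0 ≤ t_r ≤ ⋯ ≤ t_1 ≤ 1}. -/
open MeasureTheory NNReal

/-- The graph parametrization `Φ(X') = (X', φ(X'))`, componentwise:
`Φ_j(X') = X'_j` for `j < n`, `Φ_n(X') = φ(X')`. -/
noncomputable def graphComp (d : ℕ) (φ : EuclideanSpace ℝ (Fin d) → ℝ)
    (j : Fin (d + 1)) (X' : EuclideanSpace ℝ (Fin d)) : ℝ :=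
  if h : j = Fin.last d then φ X' else X' (j.castPred h)

/-- The Finset of multi-indices `β ∈ ℕ₀^{d+1}` with `|β| ≤ r`. -/
def multiIndicesLE (d r : ℕ) : Finset (Fin (d + 1) → ℕ) :=
  (Fintype.piFinset fun _ : Fin (d + 1) => Finset.range (r + 1)).filter
    (fun β => ∑ i, β i ≤ r)

/-- The Taylor-type remainder
`R_α(X', Y') = g_α(X') - Σ_{|β| ≤ m-1-|α|} (1/β!) g_{α+β}(Y') (Φ(X') - Φ(Y'))^β`. -/
noncomputable def taylorRem (d m : ℕ) (φ : EuclideanSpace ℝ (Fin d) → ℝ)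
    (g : (Fin (d + 1) → ℕ) → EuclideanSpace ℝ (Fin d) → ℂ)
    (α : Fin (d + 1) → ℕ) (X' Y' : EuclideanSpace ℝ (Fin d)) : ℂ :=
  g α X' - ∑ β ∈ multiIndicesLE d (m - 1 - ∑ i, α i),
    (1 / (∏ i, Nat.factorial (β i) : ℂ)) * g (α + β) Y' *
      ((∏ i, (graphComp d φ i X' - graphComp d φ i Y') ^ β i : ℝ) : ℂ)

/-- The nested simplex integral
`∫_0^{t} w_1(t_1) ∫_0^{t_1} w_2(t_2) ⋯ ∫_0^{t_{r-1}} w_r(t_r) h(t_r) dt_r ⋯ dt_1`. -/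
noncomputable def nestedInt (h : ℝ → ℂ) : List (ℝ → ℝ) → ℝ → ℂ
  | [], t => h t
  | w :: ws, t => ∫ s in Set.Ioc (0 : ℝ) t, (w s : ℂ) * nestedInt h ws s

section AbsolutelyContinuous

variable {F : Type*} [NormedAddCommGroup F] {a b : ℝ}

theorem LipschitzWith.absolutelyContinuousOnInterval {f : ℝ → F} {K : ℝ≥0}
    (hf : LipschitzWith K f) : AbsolutelyContinuousOnInterval f a b :=
  (hf.lipschitzOnWith).absolutelyContinuousOnInterval

namespace AbsolutelyContinuousOnInterval

theorem const (c : F) : AbsolutelyContinuousOnInterval (fun _ => c) a b :=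
  (LipschitzWith.const c).absolutelyContinuousOnInterval

theorem congr_of_eqOn {f g : ℝ → F} (hf : AbsolutelyContinuousOnInterval f a b)
    (h : Set.EqOn g f (Set.uIcc a b)) : AbsolutelyContinuousOnInterval g a b := by
  rw [absolutelyContinuousOnInterval_iff] at hf ⊢
  intro ε hε
  obtain ⟨δ, hδ, H⟩ := hf ε hε
  refine ⟨δ, hδ, fun I hI hlt => ?_⟩
  rw [Finset.sum_congr rfl fun i hi => by rw [h (hI.1 i hi).1, h (hI.1 i hi).2]]
  exact H I hI hlt

theorem finsetSum {ι : Type*} (s : Finset ι) {f : ι → ℝ → F}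
    (hf : ∀ i ∈ s, AbsolutelyContinuousOnInterval (f i) a b) :
    AbsolutelyContinuousOnInterval (fun x => ∑ i ∈ s, f i x) a b := by
  classical
  induction s using Finset.induction_on with
  | empty => simpa using const (0 : F)
  | insert i s hi ih =>
    simp only [Finset.sum_insert hi]
    exact (hf i (by simp)).fun_add (ih fun j hj => hf j (by simp [hj]))

theorem finsetProd {ι : Type*} (s : Finset ι) {f : ι → ℝ → ℝ}
    (hf : ∀ i ∈ s, AbsolutelyContinuousOnInterval (f i) a b) :
    AbsolutelyContinuousOnInterval (fun x => ∏ i ∈ s, f i x) a b := by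
  classical
  induction s using Finset.induction_on with
  | empty => simpa using const (1 : ℝ)
  | insert i s hi ih =>
    simp only [Finset.prod_insert hi]
    exact (hf i (by simp)).fun_mul (ih fun j hj => hf j (by simp [hj]))

theorem pow {f : ℝ → ℝ} (hf : AbsolutelyContinuousOnInterval f a b) (n : ℕ) :
    AbsolutelyContinuousOnInterval (fun x => f x ^ n) a b := by
  simpa using finsetProd (Finset.range n) fun _ _ => hf

end AbsolutelyContinuousOnInterval

/-- The primitive of an interval integrable complex function is absolutely continuous. -/
theorem IntervalIntegrable.absolutelyContinuousOnInterval_primitive {f : ℝ → ℂ}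
    (hf : IntervalIntegrable f volume a b) :
    AbsolutelyContinuousOnInterval (fun x => ∫ t in a..x, f t) a b := by
  have hre : IntervalIntegrable (fun t => (f t).re) volume a b := ⟨hf.1.re, hf.2.re⟩
  have him : IntervalIntegrable (fun t => (f t).im) volume a b := ⟨hf.1.im, hf.2.im⟩
  have h := ((hre.absolutelyContinuousOnInterval_intervalIntegral Set.left_mem_uIcc).fun_smul
    (AbsolutelyContinuousOnInterval.const (1 : ℂ))).fun_add
    ((him.absolutelyContinuousOnInterval_intervalIntegral Set.left_mem_uIcc).fun_smul
    (AbsolutelyContinuousOnInterval.const Complex.I))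
  refine h.congr_of_eqOn fun x hx => ?_
  have hx' : IntervalIntegrable f volume a x := hf.mono_set (Set.uIcc_subset_uIcc_left hx)
  apply Complex.ext
  · simpa using (Complex.reCLM.intervalIntegral_comp_comm hx').symm
  · simpa using (Complex.imCLM.intervalIntegral_comp_comm hx').symm

/-- The fundamental theorem of calculus for complex absolutely continuous functions. -/
theorem AbsolutelyContinuousOnInterval.integral_eq_sub_of_ae_hasDerivAt {f f' : ℝ → ℂ}
    (hf : AbsolutelyContinuousOnInterval f a b) (hf' : IntervalIntegrable f' volume a b)
    (hderiv : ∀ᵐ x, HasDerivAt f (f' x) x) : ∫ x in a..b, f' x = f b - f a := by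
  have hac := hf.fun_sub hf'.absolutelyContinuousOnInterval_primitive
  obtain ⟨C, hC⟩ := hac.const_of_ae_hasDerivAt_zero (by
    filter_upwards [hderiv, hf'.ae_hasDerivAt_integral] with x hx₁ hx₂ hx₃
    simpa using hx₁.fun_sub (hx₂ hx₃ a Set.left_mem_uIcc))
  have ha := hC a Set.left_mem_uIcc
  have hb := hC b Set.right_mem_uIcc
  simp only [intervalIntegral.integral_same, sub_zero] at ha
  rw [ha, ← hb]
  ring

end AbsolutelyContinuous

section MultiIndex

theorem mem_multiIndicesLE {d r : ℕ} {β : Fin (d + 1) → ℕ} :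
    β ∈ multiIndicesLE d r ↔ ∑ i, β i ≤ r := by
  simp only [multiIndicesLE, Finset.mem_filter, Fintype.mem_piFinset, Finset.mem_range,
    and_iff_right_iff_imp]
  intro h i
  have := Finset.single_le_sum (f := β) (fun _ _ => Nat.zero_le _) (Finset.mem_univ i)
  omega

theorem sum_add_single {n : ℕ} (β : Fin n → ℕ) (j : Fin n) :
    ∑ i, (β + Pi.single j 1 : Fin n → ℕ) i = ∑ i, β i + 1 := by
  simp [Finset.sum_add_distrib]

theorem prod_factorial_add_single {n : ℕ} (β : Fin n → ℕ) (j : Fin n) :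
    ∏ i, (((β + Pi.single j 1 : Fin n → ℕ) i).factorial : ℂ) = (β j + 1) * ∏ i, ((β i).factorial : ℂ) := by
  rw [← Finset.mul_prod_erase _ _ (Finset.mem_univ j),
    ← Finset.mul_prod_erase _ (fun i => ((β i).factorial : ℂ)) (Finset.mem_univ j),
    Finset.prod_congr (g := fun i => ((β i).factorial : ℂ)) rfl]
  · simp [Nat.factorial_succ, mul_assoc]
  · intro i hi
    simp [Finset.ne_of_mem_erase hi]

/-- Differentiating the exponential-type weights `1/β!` shifts the multi-index. -/
theorem sum_multiIndicesLE_succ {d : ℕ} (r : ℕ) (j : Fin (d + 1))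
    (c v : (Fin (d + 1) → ℕ) → ℂ) :
    ∑ β ∈ multiIndicesLE d (r + 1), (1 / (∏ i, Nat.factorial (β i) : ℂ)) * c β *
        (β j * v (β - Pi.single j 1)) =
      ∑ β ∈ multiIndicesLE d r, (1 / (∏ i, Nat.factorial (β i) : ℂ)) *
        c (Pi.single j 1 + β) * v β := by
  symm
  refine Finset.sum_bij_ne_zero (fun β _ _ => β + Pi.single j 1) ?_ ?_ ?_ ?_
  · intro β hβ _
    rw [mem_multiIndicesLE] at hβ ⊢
    rw [sum_add_single]
    omega
  · intro β _ _ γ _ _ h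
    exact add_right_cancel h
  · intro β hβ hne
    have hj : β j ≠ 0 := by
      rintro h
      simp [h] at hne
    have hle : Pi.single j 1 ≤ β := by
      intro i
      by_cases hi : i = j
      · subst hi
        simp
        omega
      · simp [hi]
    have heq : β - Pi.single j 1 + Pi.single j 1 = β := tsub_add_cancel_of_le hle
    have hβ' : β - Pi.single j 1 ∈ multiIndicesLE d r := by
      rw [mem_multiIndicesLE] at hβ ⊢
      have := sum_add_single (β - Pi.single j 1) j
      rw [heq] at this
      omega
    refine ⟨β - Pi.single j 1, hβ', ?_, heq⟩
    have hfac : (∏ i, Nat.factorial ((β - Pi.single j 1 : Fin (d + 1) → ℕ) i) : ℂ) ≠ 0 :=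
      Finset.prod_ne_zero_iff.2 fun i _ => by exact_mod_cast Nat.factorial_ne_zero _
    rw [add_comm (Pi.single j 1), heq]
    have h1 : c β ≠ 0 := fun h => by simp [h] at hne
    have h2 : v (β - Pi.single j 1) ≠ 0 := fun h => by simp [h] at hne
    exact mul_ne_zero (mul_ne_zero (one_div_ne_zero hfac) h1) h2
  · intro β _ _
    have hfac : (∏ i, Nat.factorial (β i) : ℂ) ≠ 0 :=
      Finset.prod_ne_zero_iff.2 fun i _ => by exact_mod_cast Nat.factorial_ne_zero _
    have hj : (β j + 1 : ℂ) ≠ 0 := Nat.cast_add_one_ne_zero (β j)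
    rw [prod_factorial_add_single, add_tsub_cancel_right, add_comm β]
    simp only [Pi.add_apply, Pi.single_eq_same, Nat.cast_add, Nat.cast_one]
    rw [add_comm (1 : ℂ)]
    field_simp

theorem HasDerivAt.prod_pow_multiIndex {n : ℕ} {u : Fin n → ℝ → ℝ} {u' : Fin n → ℝ} {x : ℝ}
    (hu : ∀ i, HasDerivAt (u i) (u' i) x) (β : Fin n → ℕ) :
    HasDerivAt (fun t => ∏ i, u i t ^ β i)
      (∑ j, β j * (∏ i, u i x ^ (β - Pi.single j 1 : Fin n → ℕ) i) * u' j) x := by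
  refine (HasDerivAt.fun_finsetProd (u := Finset.univ) fun i _ =>
    (hu i).fun_pow (β i)).congr_deriv ?_
  refine Finset.sum_congr rfl fun j _ => ?_
  have h : ∏ i ∈ Finset.univ.erase j, u i x ^ (β - Pi.single j 1 : Fin n → ℕ) i =
      ∏ i ∈ Finset.univ.erase j, u i x ^ β i :=
    Finset.prod_congr rfl fun i hi => by simp [Finset.ne_of_mem_erase hi]
  have hj := Finset.mul_prod_erase Finset.univ
    (fun i => u i x ^ (β - Pi.single j 1 : Fin n → ℕ) i) (Finset.mem_univ j)
  rw [h] at hj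
  rw [← hj]
  simp
  ring

end MultiIndex

section Curve

theorem intervalIntegrable_ofReal {f : ℝ → ℝ} {a b : ℝ} (hf : IntervalIntegrable f volume a b) :
    IntervalIntegrable (fun t => (f t : ℂ)) volume a b :=
  ⟨hf.1.ofReal, hf.2.ofReal⟩

theorem nestedInt_cons (h : ℝ → ℂ) (w : ℝ → ℝ) (ws : List (ℝ → ℝ)) {t : ℝ} (ht : 0 ≤ t) :
    nestedInt h (w :: ws) t = ∫ s in (0 : ℝ)..t, (w s : ℂ) * nestedInt h ws s := by
  rw [nestedInt, intervalIntegral.integral_of_le ht]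

theorem continuous_nestedInt {h : ℝ → ℂ} (hh : Continuous h) (ws : List (ℝ → ℝ))
    (hws : ∀ w ∈ ws, ∀ a b, IntervalIntegrable w volume a b) : Continuous (nestedInt h ws) := by
  induction ws with
  | nil => exact hh
  | cons w ws ih =>
    have hc := ih fun v hv => hws v (by simp [hv])
    have hint (a b : ℝ) :
        IntervalIntegrable (fun s => (w s : ℂ) * nestedInt h ws s) volume a b :=
      (intervalIntegrable_ofReal (hws w (by simp) a b)).mul_continuousOn hc.continuousOn
    have heq : nestedInt h (w :: ws) =
        fun t => ∫ s in (0 : ℝ)..max 0 t, (w s : ℂ) * nestedInt h ws s := by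
      funext t
      rcases le_total 0 t with ht | ht
      · rw [max_eq_right ht, nestedInt_cons _ _ _ ht]
      · simp [nestedInt, max_eq_left ht, Set.Ioc_eq_empty (not_lt.2 ht)]
    rw [heq]
    exact (intervalIntegral.continuous_primitive hint 0).comp (by fun_prop)

/-- The Taylor-type remainder of order `r` at `0` for a family `G` of functions along a curve `u`
in `ℝ^{d+1}`. -/
noncomputable def curveRem {d : ℕ} (u : Fin (d + 1) → ℝ → ℝ) (G : (Fin (d + 1) → ℕ) → ℝ → ℂ)
    (r : ℕ) (α : Fin (d + 1) → ℕ) (t : ℝ) : ℂ :=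
  G α t - ∑ β ∈ multiIndicesLE d r, (1 / (∏ i, Nat.factorial (β i) : ℂ)) * G (α + β) 0 *
    ((∏ i, u i t ^ β i : ℝ) : ℂ)

variable {d : ℕ} {u : Fin (d + 1) → ℝ → ℝ} {G : (Fin (d + 1) → ℕ) → ℝ → ℂ}

theorem curveRem_zero (hu0 : ∀ i, u i 0 = 0) (r : ℕ) (α : Fin (d + 1) → ℕ) :
    curveRem u G r α 0 = 0 := by
  rw [curveRem, Finset.sum_eq_single 0]
  · simp
  · intro β _ hβ
    obtain ⟨i, hi⟩ := Function.ne_iff.1 hβ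
    have h : ∏ i, u i 0 ^ β i = 0 :=
      Finset.prod_eq_zero (Finset.mem_univ i) (by rw [hu0, zero_pow (by simpa using hi)])
    simp [h]
  · intro h
    simp [mem_multiIndicesLE] at h

theorem hasDerivAt_curveRem {w : Fin (d + 1) → ℝ} {r : ℕ} {α : Fin (d + 1) → ℕ} {t : ℝ}
    (hu : ∀ i, HasDerivAt (u i) (w i) t)
    (hG : HasDerivAt (G α) (∑ j, G (α + Pi.single j 1) t * (w j : ℂ)) t) :
    HasDerivAt (curveRem u G (r + 1) α)
      (∑ j, (w j : ℂ) * curveRem u G r (α + Pi.single j 1) t) t := by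
  refine (hG.fun_sub (HasDerivAt.fun_sum fun β _ =>
    ((HasDerivAt.prod_pow_multiIndex hu β).ofReal_comp).const_mul
      ((1 / (∏ i, Nat.factorial (β i) : ℂ)) * G (α + β) 0))).congr_deriv ?_
  simp only [curveRem, mul_sub, Finset.sum_sub_distrib]
  congr 1
  · exact Finset.sum_congr rfl fun j _ => mul_comm _ _
  · simp only [Complex.ofReal_sum, Finset.mul_sum]
    rw [Finset.sum_comm]
    refine Finset.sum_congr rfl fun j _ => ?_
    have h := sum_multiIndicesLE_succ r j (fun β => G (α + β) 0)
      (fun β => ((∏ i, u i t ^ β i : ℝ) : ℂ))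
    simp only [← add_assoc] at h
    rw [← Finset.mul_sum, ← h, Finset.mul_sum]
    refine Finset.sum_congr rfl fun β _ => ?_
    push_cast
    ring

theorem curveRem_eq_sum_nestedInt {w : Fin (d + 1) → ℝ → ℝ} (N : ℕ) (hu0 : ∀ i, u i 0 = 0)
    (huLip : ∀ i, ∃ K, LipschitzWith K (u i))
    (hu : ∀ i, ∀ᵐ t, HasDerivAt (u i) (w i t) t)
    (hw : ∀ i a b, IntervalIntegrable (w i) volume a b)
    (hGLip : ∀ α, ∑ i, α i ≤ N → ∃ K, LipschitzWith K (G α))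
    (hG : ∀ α, ∑ i, α i < N →
      ∀ᵐ t, HasDerivAt (G α) (∑ j, G (α + Pi.single j 1) t * (w j t : ℂ)) t)
    (r : ℕ) (α : Fin (d + 1) → ℕ) (hα : ∑ i, α i + r = N) {t : ℝ} (ht : 0 ≤ t) :
    curveRem u G r α t = ∑ js : Fin r → Fin (d + 1),
      nestedInt (fun s => G (α + ∑ k, Pi.single (js k) 1) s - G (α + ∑ k, Pi.single (js k) 1) 0)
        (List.ofFn fun k => w (js k)) t := by
  induction r generalizing α t with
  | zero =>
    have h0 : multiIndicesLE d 0 = {0} := by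
      ext β
      simp [mem_multiIndicesLE, funext_iff]
    simp [curveRem, h0, nestedInt]
  | succ r ih =>
    have hαj (j : Fin (d + 1)) : ∑ i, (α + Pi.single j 1 : Fin (d + 1) → ℕ) i + r = N := by
      rw [sum_add_single]
      omega
    have hac : AbsolutelyContinuousOnInterval (curveRem u G (r + 1) α) 0 t := by
      obtain ⟨K, hK⟩ := hGLip α (by omega)
      refine hK.absolutelyContinuousOnInterval.fun_sub
        (AbsolutelyContinuousOnInterval.finsetSum _ fun β _ => ?_)
      have h := (AbsolutelyContinuousOnInterval.finsetProd Finset.univ fun i _ =>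
        ((huLip i).choose_spec.absolutelyContinuousOnInterval (a := 0) (b := t)).pow
          (β i)).fun_smul (AbsolutelyContinuousOnInterval.const
          ((1 / (∏ i, Nat.factorial (β i) : ℂ)) * G (α + β) 0))
      simpa only [Complex.real_smul, mul_comm] using h
    have hcont (j : Fin (d + 1)) (js : Fin r → Fin (d + 1)) :
        Continuous (nestedInt (fun s => G (α + Pi.single j 1 + ∑ k, Pi.single (js k) 1) s -
          G (α + Pi.single j 1 + ∑ k, Pi.single (js k) 1) 0) (List.ofFn fun k => w (js k))) := by
      refine continuous_nestedInt ?_ _ ?_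
      · obtain ⟨K, hK⟩ := hGLip (α + Pi.single j 1 + ∑ k, Pi.single (js k) 1) (by
          rw [← hαj j]
          simp only [Pi.add_apply, Finset.sum_apply, Finset.sum_add_distrib]
          rw [Finset.sum_comm (s := Finset.univ) (t := (Finset.univ : Finset (Fin r)))]
          simp)
        exact hK.continuous.sub continuous_const
      · simp only [List.mem_ofFn]
        rintro _ ⟨k, rfl⟩
        exact hw _
    have hint (j : Fin (d + 1)) (js : Fin r → Fin (d + 1)) :=
      (intervalIntegrable_ofReal (hw j 0 t)).mul_continuousOn (hcont j js).continuousOn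
    have hcongr : ∀ s ∈ Set.uIcc 0 t,
        ∑ j, (w j s : ℂ) * curveRem u G r (α + Pi.single j 1) s =
          ∑ j, ∑ js : Fin r → Fin (d + 1), (w j s : ℂ) *
            nestedInt (fun s => G (α + Pi.single j 1 + ∑ k, Pi.single (js k) 1) s -
              G (α + Pi.single j 1 + ∑ k, Pi.single (js k) 1) 0)
              (List.ofFn fun k => w (js k)) s := by
      intro s hs
      rw [Set.uIcc_of_le ht] at hs
      refine Finset.sum_congr rfl fun j _ => ?_
      rw [ih _ (hαj j) hs.1, Finset.mul_sum]
    have hint' : IntervalIntegrable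
        (fun s => ∑ j, (w j s : ℂ) * curveRem u G r (α + Pi.single j 1) s) volume 0 t := by
      refine (IntervalIntegrable.sum Finset.univ fun j _ =>
        IntervalIntegrable.sum Finset.univ fun js _ => hint j js).congr fun s hs => ?_
      rw [hcongr s (Set.uIoc_subset_uIcc hs)]
      simp
    have hftc := hac.integral_eq_sub_of_ae_hasDerivAt hint' (by
      filter_upwards [ae_all_iff.2 hu, hG α (by omega)] with s hs₁ hs₂
      exact hasDerivAt_curveRem hs₁ hs₂)
    rw [curveRem_zero hu0, sub_zero] at hftc
    rw [← hftc, intervalIntegral.integral_congr hcongr, intervalIntegral.integral_finsetSum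
      fun j _ => by
      simpa only [Finset.sum_fn] using IntervalIntegrable.sum Finset.univ fun js _ => hint j js,
      ← (Fin.consEquiv fun _ : Fin (r + 1) => Fin (d + 1)).sum_comp, Fintype.sum_prod_type]
    refine Finset.sum_congr rfl fun j _ => ?_
    rw [intervalIntegral.integral_finsetSum fun js _ => hint j js]
    refine Finset.sum_congr rfl fun js _ => ?_
    simp [List.ofFn_succ, nestedInt_cons _ _ _ ht, Fin.sum_univ_succ, add_assoc]

end Curve

section Lines

theorem ae_ae_lineMap {E : Type*} [NormedAddCommGroup E] [NormedSpace ℝ E]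
    [FiniteDimensional ℝ E] [MeasureSpace E] [BorelSpace E]
    [(volume : Measure E).IsAddHaarMeasure] {p : E → Prop} (hp : ∀ᵐ x : E, p x) :
    ∀ᵐ P : E × E, ∀ᵐ t : ℝ, p (P.2 + t • (P.1 - P.2)) := by
  obtain ⟨s, hs, hsm, hsp⟩ : ∃ s : Set E, (∀ x ∈ s, p x) ∧ MeasurableSet s ∧ ∀ᵐ x, x ∈ s := by
    refine ⟨(toMeasurable volume {x | ¬ p x})ᶜ, fun x hx => ?_,
      (measurableSet_toMeasurable _ _).compl, ?_⟩
    · by_contra h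
      exact hx (subset_toMeasurable _ _ h)
    · rw [ae_iff]
      simpa [measure_toMeasurable] using ae_iff.1 hp
  have hmeas : MeasurableSet {q : (E × E) × ℝ | q.1.2 + q.2 • (q.1.1 - q.1.2) ∈ s} :=
    hsm.preimage (by fun_prop)
  have key : ∀ᵐ P : E × E, ∀ᵐ t : ℝ, P.2 + t • (P.1 - P.2) ∈ s := by
    rw [Measure.ae_ae_comm (p := fun (P : E × E) (t : ℝ) => P.2 + t • (P.1 - P.2) ∈ s) hmeas]
    filter_upwards [Measure.ae_ne volume (0 : ℝ)] with t ht
    have : (volume : Measure (E × E)).IsAddHaarMeasure :=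
      Measure.prod.instIsAddHaarMeasure volume volume
    let L : E × E →ₗ[ℝ] E :=
      LinearMap.snd ℝ E E + t • (LinearMap.fst ℝ E E - LinearMap.snd ℝ E E)
    have hL : Function.Surjective L := fun x => ⟨(t⁻¹ • x, 0), by simp [L, smul_smul, ht]⟩
    exact (ae_comp_linearMap_mem_iff L volume volume hL hsm).2 hsp
  filter_upwards [key] with P hP
  filter_upwards [hP] with t ht using hs _ ht

theorem lipschitzWith_line {E : Type*} [NormedAddCommGroup E] [NormedSpace ℝ E] (y v : E) :
    LipschitzWith ‖v‖₊ fun t : ℝ => y + t • v :=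
  LipschitzWith.of_dist_le_mul fun s t => by
    simp [dist_eq_norm, ← sub_smul, norm_smul, mul_comm]

theorem intervalIntegrable_fderiv_line {E : Type*} [NormedAddCommGroup E] [NormedSpace ℝ E]
    [FiniteDimensional ℝ E] [MeasurableSpace E] [BorelSpace E] {f : E → ℝ} {K : ℝ≥0}
    (hf : LipschitzWith K f) (y v : E) (a b : ℝ) :
    IntervalIntegrable (fun t : ℝ => fderiv ℝ f (y + t • v) v) volume a b := by
  have hmeas : Measurable fun t : ℝ => fderiv ℝ f (y + t • v) v :=
    (measurable_fderiv_apply_const ℝ f v).comp (by fun_prop)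
  refine (intervalIntegrable_const (c := K * ‖v‖)).mono_fun hmeas.aestronglyMeasurable ?_
  refine Filter.Eventually.of_forall fun t => ?_
  exact ((fderiv ℝ f _).le_of_opNorm_le (norm_fderiv_le_of_lipschitz ℝ hf) v).trans
    (le_abs_self _)

theorem graphComp_lipschitz {d : ℕ} {φ : EuclideanSpace ℝ (Fin d) → ℝ} {K : ℝ≥0}
    (hφ : LipschitzWith K φ) (j : Fin (d + 1)) : ∃ K, LipschitzWith K (graphComp d φ j) := by
  by_cases h : j = Fin.last d
  · have heq : graphComp d φ j = φ := by
      funext X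
      simp [graphComp, h]
    exact ⟨K, by rwa [heq]⟩
  · refine ⟨1, ?_⟩
    have : graphComp d φ j = fun X => X (j.castPred h) := by
      funext X
      simp [graphComp, h]
    rw [this]
    refine LipschitzWith.of_dist_le_mul fun X Y => ?_
    simpa [dist_eq_norm] using PiLp.norm_apply_le (X - Y) (j.castPred h)

theorem fderiv_apply_eq_of_single {d : ℕ} {ι : Type*} [Fintype ι]
    {A : EuclideanSpace ℝ (Fin d) →L[ℝ] ℂ} {B : ι → EuclideanSpace ℝ (Fin d) →L[ℝ] ℝ} {c : ι → ℂ}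
    (h : ∀ k, A (EuclideanSpace.single k 1) =
      ∑ j, c j * ((B j (EuclideanSpace.single k 1) : ℝ) : ℂ)) (v : EuclideanSpace ℝ (Fin d)) :
    A v = ∑ j, c j * ((B j v : ℝ) : ℂ) := by
  have hv : v = ∑ k, v k • EuclideanSpace.single k (1 : ℝ) := by
    simpa using ((EuclideanSpace.basisFun (Fin d) ℝ).sum_repr v).symm
  rw [hv]
  simp only [map_sum, map_smul, h, Complex.ofReal_sum, Finset.mul_sum, smul_eq_mul,
    Complex.ofReal_mul, Complex.real_smul]
  rw [Finset.sum_comm]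
  exact Finset.sum_congr rfl fun j _ => Finset.sum_congr rfl fun k _ => by ring

theorem HasFDerivAt.hasDerivAt_line {E F : Type*} [NormedAddCommGroup E] [NormedSpace ℝ E]
    [NormedAddCommGroup F] [NormedSpace ℝ F] {f : E → F} {f' : E →L[ℝ] F} {y v : E} {t : ℝ}
    (hf : HasFDerivAt f f' (y + t • v)) : HasDerivAt (fun s : ℝ => f (y + s • v)) (f' v) t := by
  have h : HasDerivAt (fun s : ℝ => y + s • v) v t := by
    simpa using ((hasDerivAt_id t).smul_const v).const_add y
  exact hf.comp_hasDerivAt t h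

end Lines

/-- If the boundary data `g_α = f_α ∘ Φ`, `|α| ≤ m-1`, are Lipschitz and
satisfy the compatibility (chain rule) conditions
`∂_k g_α = Σ_j g_{α+e_j} ∂_k Φ_j` a.e. for `|α| ≤ m-2`, then for every `|α| ≤ m-2`,
with `r = m-1-|α|`, the remainder `R_α(X', Y')` equals, for a.e. `(X', Y')`, the sum over
tuples `(j_1, …, j_r)` of the iterated simplex integrals of
`[g_{α+e_{j_1}+⋯+e_{j_r}}(Y'+t_r(X'-Y')) - g_{α+e_{j_1}+⋯+e_{j_r}}(Y')]
  ∏_k ∇Φ_{j_k}(Y'+t_k(X'-Y'))·(X'-Y')`. -/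
theorem stmt_16 (d : ℕ) (hd : 1 ≤ d) (m : ℕ) (hm : 2 ≤ m)
    (φ : EuclideanSpace ℝ (Fin d) → ℝ) (Lφ : ℝ≥0) (hφ : LipschitzWith Lφ φ)
    (g : (Fin (d + 1) → ℕ) → EuclideanSpace ℝ (Fin d) → ℂ)
    (hgLip : ∀ α : Fin (d + 1) → ℕ, (∑ i, α i) ≤ m - 1 →
      ∃ L : ℝ≥0, LipschitzWith L (g α))
    (hchain : ∀ α : Fin (d + 1) → ℕ, (∑ i, α i) ≤ m - 2 → ∀ k : Fin d,
      ∀ᵐ X' : EuclideanSpace ℝ (Fin d),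
        fderiv ℝ (g α) X' (EuclideanSpace.single k 1) =
          ∑ j : Fin (d + 1), g (α + Pi.single j 1) X' *
            ((fderiv ℝ (graphComp d φ j) X' (EuclideanSpace.single k 1) : ℝ) : ℂ)) :
    ∀ α : Fin (d + 1) → ℕ, (∑ i, α i) ≤ m - 2 →
      ∀ᵐ P : EuclideanSpace ℝ (Fin d) × EuclideanSpace ℝ (Fin d),
        taylorRem d m φ g α P.1 P.2 =
          ∑ js : Fin (m - 1 - ∑ i, α i) → Fin (d + 1),
            nestedInt
              (fun t =>
                g (α + ∑ k, Pi.single (js k) 1) (P.2 + t • (P.1 - P.2)) -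
                  g (α + ∑ k, Pi.single (js k) 1) P.2)
              (List.ofFn fun k => fun t =>
                fderiv ℝ (graphComp d φ (js k)) (P.2 + t • (P.1 - P.2)) (P.1 - P.2))
              1 := by
  intro α hα
  have hΦLip := graphComp_lipschitz hφ
  have hΦ : ∀ᵐ X : EuclideanSpace ℝ (Fin d), ∀ j, DifferentiableAt ℝ (graphComp d φ j) X :=
    ae_all_iff.2 fun j => (hΦLip j).choose_spec.ae_differentiableAt
  have hg : ∀ᵐ X : EuclideanSpace ℝ (Fin d), ∀ γ : Fin (d + 1) → ℕ, ∑ i, γ i < m - 1 →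
      DifferentiableAt ℝ (g γ) X ∧ ∀ k : Fin d,
        fderiv ℝ (g γ) X (EuclideanSpace.single k 1) =
          ∑ j : Fin (d + 1), g (γ + Pi.single j 1) X *
            ((fderiv ℝ (graphComp d φ j) X (EuclideanSpace.single k 1) : ℝ) : ℂ) := by
    refine ae_all_iff.2 fun γ => ?_
    by_cases hγ : ∑ i, γ i < m - 1
    · obtain ⟨K, hK⟩ := hgLip γ hγ.le
      filter_upwards [hK.ae_differentiableAt, ae_all_iff.2 (hchain γ (by omega))]
        with X h₁ h₂ _ using ⟨h₁, h₂⟩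
    · exact Filter.Eventually.of_forall fun X h => absurd h hγ
  filter_upwards [ae_ae_lineMap hΦ, ae_ae_lineMap hg] with P hP₁ hP₂
  have key := curveRem_eq_sum_nestedInt
    (u := fun i t => graphComp d φ i (P.2 + t • (P.1 - P.2)) - graphComp d φ i P.2)
    (G := fun γ t => g γ (P.2 + t • (P.1 - P.2)))
    (w := fun i t => fderiv ℝ (graphComp d φ i) (P.2 + t • (P.1 - P.2)) (P.1 - P.2))
    (m - 1) (by simp)
    (fun i => ⟨_, ((hΦLip i).choose_spec.comp (lipschitzWith_line _ _)).sub
      (LipschitzWith.const _)⟩)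
    (fun i => by
      filter_upwards [hP₁] with t ht
      exact (ht i).hasFDerivAt.hasDerivAt_line.sub_const _)
    (fun i => intervalIntegrable_fderiv_line (hΦLip i).choose_spec _ _)
    (fun γ hγ => ⟨_, (hgLip γ hγ).choose_spec.comp (lipschitzWith_line _ _)⟩)
    (fun γ hγ => by
      filter_upwards [hP₂] with t ht
      obtain ⟨h₁, h₂⟩ := ht γ hγ
      exact h₁.hasFDerivAt.hasDerivAt_line.congr_deriv (fderiv_apply_eq_of_single h₂ _))
    (m - 1 - ∑ i, α i) α (by omega) zero_le_one
  simpa [curveRem, taylorRem] using key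
end

section
/- For ε ∈ (0, 1/2) define φ_ε : ℝ → ℝ by φ_ε(x) := x sin(ε log(1/|x|)) for x ≠ 0 and φ_ε(0) := 0, so that for x ≠ 0 its derivative is φ'_ε(x) = sin(ε log(1/|x|)) − ε cos(ε log(1/|x|)). Then there exist absolute constants C > 0 and 0 < c₁ ≤ c₂ such that for every ε ∈ (0, 1/2): [φ'_ε]_{BMO(ℝ)} ≤ C ε, while c₁ ≤ ‖φ'_ε‖_{L_∞(ℝ)} ≤ c₂. -/
open MeasureTheory ENNReal

/-- `φ_ε(x) = x sin(ε log(1/|x|))` (and `φ_ε(0) = 0`). -/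
noncomputable def phiEps (ε x : ℝ) : ℝ :=
  if x = 0 then 0 else x * Real.sin (ε * Real.log (1 / |x|))

/-- `φ'_ε(x) = sin(ε log(1/|x|)) - ε cos(ε log(1/|x|))` for `x ≠ 0`. -/
noncomputable def phiEpsDeriv (ε x : ℝ) : ℝ :=
  Real.sin (ε * Real.log (1 / |x|)) - ε * Real.cos (ε * Real.log (1 / |x|))

/-- The BMO seminorm on `ℝ`: the supremum over bounded (open) intervals `I = B(z, r)` of
the mean value of `|f - ⨍_I f|` over `I`. -/
noncomputable def bmoReal (f : ℝ → ℝ) : ℝ≥0∞ :=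
  ⨆ (z : ℝ) (r : ℝ) (_ : 0 < r),
    (volume (Metric.ball z r))⁻¹ *
      ∫⁻ x in Metric.ball z r, ENNReal.ofReal |f x - ⨍ y in Metric.ball z r, f y|

/-- Averages minimise the mean oscillation up to a factor of two. -/
lemma integral_abs_sub_average_le {α : Type*} [MeasurableSpace α] {μ : Measure α}
    [IsFiniteMeasure μ] {f : α → ℝ} (hf : Integrable f μ) (c : ℝ) :
    ∫ x, |f x - ⨍ y, f y ∂μ| ∂μ ≤ 2 * ∫ x, |f x - c| ∂μ := by
  rcases eq_or_ne μ 0 with rfl | hμ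
  · simp
  have hpos : 0 < μ.real Set.univ := by
    simpa [Measure.real, ENNReal.toReal_pos_iff, measure_lt_top, pos_iff_ne_zero] using hμ
  have hc : Integrable (fun x => f x - c) μ := hf.sub (integrable_const c)
  have hdiff : μ.real Set.univ * |c - ⨍ y, f y ∂μ| ≤ ∫ x, |f x - c| ∂μ := by
    have h1 : μ.real Set.univ * (⨍ y, f y ∂μ) = ∫ y, f y ∂μ := by
      simpa using measure_smul_average μ f
    have h2 : μ.real Set.univ * |c - ⨍ y, f y ∂μ| = |∫ x, (f x - c) ∂μ| := by
      rw [integral_sub hf (integrable_const c), integral_const, ← h1, smul_eq_mul, ← mul_sub,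
        abs_mul, abs_of_pos hpos, abs_sub_comm]
    rw [h2]
    exact abs_integral_le_integral_abs
  calc ∫ x, |f x - ⨍ y, f y ∂μ| ∂μ
      ≤ ∫ x, (|f x - c| + |c - ⨍ y, f y ∂μ|) ∂μ :=
        integral_mono (hf.sub (integrable_const _)).abs (hc.abs.add (integrable_const _))
          fun x => abs_sub_le _ _ _
    _ = (∫ x, |f x - c| ∂μ) + μ.real Set.univ * |c - ⨍ y, f y ∂μ| := by
        rw [integral_add hc.abs (integrable_const _), integral_const, smul_eq_mul]
    _ ≤ 2 * ∫ x, |f x - c| ∂μ := by linarith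

lemma integrableOn_ball_log (z r : ℝ) :
    IntegrableOn Real.log (Metric.ball z r) := by
  rw [Real.ball_eq_Ioo]
  rcases le_total (z - r) (z + r) with h | h
  · exact ((intervalIntegrable_iff_integrableOn_Ioc_of_le h).1
      intervalIntegral.intervalIntegrable_log').mono_set Set.Ioo_subset_Ioc_self
  · simp [Set.Ioo_eq_empty_of_le h]

lemma log_le_log_add_of_mem_ball {z r x : ℝ} (hx : x ∈ Metric.ball z r) (hx0 : x ≠ 0) :
    Real.log x ≤ Real.log (|z| + r) := by
  rw [← Real.log_abs x]
  refine Real.log_le_log (abs_pos.2 hx0) ?_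
  rw [Metric.mem_ball, Real.dist_eq] at hx
  have := abs_sub_abs_le_abs_sub x z
  linarith

lemma integral_ball_log_sub_le {z r : ℝ} (hr : 0 < r) :
    ∫ x in Metric.ball z r, (Real.log (|z| + r) - Real.log x) ≤ 6 * r := by
  have hz := abs_nonneg z
  have hvol : volume.real (Metric.ball z r) = 2 * r := Real.volume_real_ball hr.le
  rcases le_total (2 * r) |z| with h | h
  · have hint : IntegrableOn (fun x => Real.log (|z| + r) - Real.log x) (Metric.ball z r) :=
      (integrableOn_const measure_ball_lt_top.ne).sub (integrableOn_ball_log z r)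
    have key : ∀ x ∈ Metric.ball z r, Real.log (|z| + r) - Real.log x ≤ 3 := by
      intro x hx
      rw [Metric.mem_ball, Real.dist_eq, abs_sub_comm] at hx
      have h1 := abs_sub_abs_le_abs_sub z x
      have hx0 : 0 < |x| := by linarith
      rw [← Real.log_abs x, ← Real.log_div (by linarith) hx0.ne']
      have h2 : (|z| + r) / |x| ≤ 3 := by
        rw [div_le_iff₀ hx0]; linarith
      exact (Real.log_le_self (by positivity)).trans h2
    calc _ ≤ ∫ _ in Metric.ball z r, (3 : ℝ) :=
          setIntegral_mono_on hint (integrableOn_const measure_ball_lt_top.ne) measurableSet_ball key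
      _ = 6 * r := by rw [setIntegral_const, hvol, smul_eq_mul]; ring
  · set M := |z| + r with hM
    have hM0 : 0 < M := by positivity
    have hsub : Metric.ball z r ⊆ Metric.ball 0 M := by
      apply Metric.ball_subset_ball'
      rw [Real.dist_eq, sub_zero]; linarith
    have hint : IntegrableOn (fun x => Real.log M - Real.log x) (Metric.ball 0 M) :=
      (integrableOn_const measure_ball_lt_top.ne).sub (integrableOn_ball_log 0 M)
    have hnn : 0 ≤ᵐ[volume.restrict (Metric.ball 0 M)] fun x => Real.log M - Real.log x := by
      filter_upwards [ae_restrict_mem measurableSet_ball,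
        ae_restrict_of_ae (Measure.ae_ne volume (0 : ℝ))] with x hx hx0
      have := log_le_log_add_of_mem_ball hx hx0
      simpa using this
    calc _ ≤ ∫ x in Metric.ball 0 M, (Real.log M - Real.log x) :=
          setIntegral_mono_set hint hnn hsub.eventuallyLE
      _ = ∫ x in (-M)..M, (Real.log M - Real.log x) := by
          rw [Real.ball_eq_Ioo, zero_sub, zero_add, ← integral_Ioc_eq_integral_Ioo,
            intervalIntegral.integral_of_le (by linarith)]
      _ = 2 * M := by
          rw [intervalIntegral.integral_sub intervalIntegrable_const
            intervalIntegral.intervalIntegrable_log', integral_log,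
            intervalIntegral.integral_const, Real.log_neg_eq_log, smul_eq_mul]
          ring
      _ ≤ 6 * r := by linarith

lemma measurable_phiEpsDeriv (ε : ℝ) : Measurable (phiEpsDeriv ε) := by
  unfold phiEpsDeriv
  fun_prop

lemma abs_phiEpsDeriv_le {ε : ℝ} (h0 : 0 < ε) (h1 : ε < 1 / 2) (x : ℝ) :
    |phiEpsDeriv ε x| ≤ 2 := by
  unfold phiEpsDeriv
  set t := ε * Real.log (1 / |x|)
  rw [abs_le]
  constructor <;>
    nlinarith [Real.sin_le_one t, Real.neg_one_le_sin t, Real.cos_le_one t,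
      Real.neg_one_le_cos t]

lemma phiEpsDeriv_eq_log (ε x : ℝ) :
    phiEpsDeriv ε x = Real.sin (-(ε * Real.log x)) - ε * Real.cos (-(ε * Real.log x)) := by
  simp [phiEpsDeriv]

lemma abs_phiEpsDeriv_sub_le {ε : ℝ} (h0 : 0 < ε) (h1 : ε < 1 / 2) (x y : ℝ) :
    |phiEpsDeriv ε x - phiEpsDeriv ε y| ≤ 2 * ε * |Real.log x - Real.log y| := by
  rw [phiEpsDeriv_eq_log, phiEpsDeriv_eq_log]
  set s := -(ε * Real.log x) with hs
  set t := -(ε * Real.log y) with ht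
  have hst : |s - t| = ε * |Real.log x - Real.log y| := by
    rw [show s - t = -(ε * (Real.log x - Real.log y)) by rw [hs, ht]; ring, abs_neg, abs_mul,
      abs_of_pos h0]
  have hsin : |Real.sin s - Real.sin t| ≤ |s - t| := by
    simpa [Real.dist_eq] using Real.lipschitzWith_sin.dist_le_mul s t
  have hcos : |Real.cos s - Real.cos t| ≤ |s - t| := by
    simpa [Real.dist_eq] using Real.lipschitzWith_cos.dist_le_mul s t
  calc |Real.sin s - ε * Real.cos s - (Real.sin t - ε * Real.cos t)|
      = |(Real.sin s - Real.sin t) - ε * (Real.cos s - Real.cos t)| := by congr 1; ring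
    _ ≤ |Real.sin s - Real.sin t| + |ε * (Real.cos s - Real.cos t)| := abs_sub _ _
    _ = |Real.sin s - Real.sin t| + ε * |Real.cos s - Real.cos t| := by
        rw [abs_mul, abs_of_pos h0]
    _ ≤ 2 * |s - t| := by nlinarith [abs_nonneg (Real.cos s - Real.cos t)]
    _ = 2 * ε * |Real.log x - Real.log y| := by rw [hst]; ring

lemma hasDerivAt_phiEps (ε : ℝ) {x : ℝ} (hx : x ≠ 0) :
    HasDerivAt (phiEps ε) (phiEpsDeriv ε x) x := by
  have h : HasDerivAt (fun y => y * Real.sin (-(ε * Real.log y))) (phiEpsDeriv ε x) x := by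
    have h1 := (((Real.hasDerivAt_log hx).const_mul ε).neg).sin
    refine ((hasDerivAt_id' x).mul h1).congr_deriv ?_
    rw [phiEpsDeriv_eq_log]
    simp only [Pi.neg_apply]
    field_simp
    ring
  refine h.congr_of_eventuallyEq (Filter.Eventually.of_forall fun y => ?_)
  by_cases hy : y = 0 <;> simp [phiEps, hy]

lemma bmoReal_phiEpsDeriv_le {ε : ℝ} (h0 : 0 < ε) (h1 : ε < 1 / 2) :
    bmoReal (phiEpsDeriv ε) ≤ ENNReal.ofReal (12 * ε) := by
  refine iSup_le fun z => iSup_le fun r => iSup_le fun hr => ?_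
  set B := Metric.ball z r
  set f := phiEpsDeriv ε
  have hf : IntegrableOn f B := by
    refine Integrable.mono' (integrableOn_const (C := (2 : ℝ)) measure_ball_lt_top.ne)
      (measurable_phiEpsDeriv ε).aestronglyMeasurable (.of_forall fun x => ?_)
    exact abs_phiEpsDeriv_le h0 h1 x
  have : IsFiniteMeasure (volume.restrict B) :=
    isFiniteMeasure_restrict.2 measure_ball_lt_top.ne
  set c := f (|z| + r)
  have hlog : IntegrableOn (fun x => Real.log (|z| + r) - Real.log x) B :=
    (integrableOn_const measure_ball_lt_top.ne).sub (integrableOn_ball_log z r)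
  have hosc : ∫ x in B, |f x - c| ≤ 2 * ε * (6 * r) := by
    calc ∫ x in B, |f x - c|
        ≤ ∫ x in B, 2 * ε * (Real.log (|z| + r) - Real.log x) := by
          refine integral_mono_ae (hf.sub (integrable_const c)).abs (hlog.const_mul _) ?_
          filter_upwards [ae_restrict_mem measurableSet_ball,
            ae_restrict_of_ae (Measure.ae_ne volume (0 : ℝ))] with x hx hx0
          refine (abs_phiEpsDeriv_sub_le h0 h1 x (|z| + r)).trans_eq ?_
          rw [abs_sub_comm, abs_of_nonneg (sub_nonneg.2 (log_le_log_add_of_mem_ball hx hx0))]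
      _ ≤ 2 * ε * (6 * r) := by
          rw [integral_const_mul]
          exact mul_le_mul_of_nonneg_left (integral_ball_log_sub_le hr) (by positivity)
  have hmain : ∫ x in B, |f x - ⨍ y in B, f y| ≤ 2 * r * (12 * ε) := by
    have := integral_abs_sub_average_le hf c
    linarith
  have hdev : IntegrableOn (fun x => |f x - ⨍ y in B, f y|) B :=
    (hf.sub (integrable_const _)).abs
  rw [← ofReal_integral_eq_lintegral_ofReal hdev (.of_forall fun _ => abs_nonneg _), Real.volume_ball, mul_comm, ← div_eq_mul_inv]
  refine ENNReal.div_le_of_le_mul ?_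
  rw [← ENNReal.ofReal_mul (by positivity), mul_comm (12 * ε)]
  exact ENNReal.ofReal_le_ofReal hmain

lemma half_le_eLpNorm_phiEpsDeriv {ε : ℝ} (h0 : 0 < ε) :
    ENNReal.ofReal (1 / 2) ≤ eLpNorm (phiEpsDeriv ε) ⊤ volume := by
  set a := Real.exp (-(Real.pi / 2 / ε)) with ha
  have ha0 : a ≠ 0 := (Real.exp_pos _).ne'
  have hval : phiEpsDeriv ε a = 1 := by
    have : -(ε * Real.log a) = Real.pi / 2 := by
      rw [ha, Real.log_exp]; field_simp
    rw [phiEpsDeriv_eq_log, this]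
    simp
  have hcont : ContinuousAt (phiEpsDeriv ε) a := by
    rw [funext (phiEpsDeriv_eq_log ε)]
    have := Real.continuousAt_log ha0
    fun_prop
  have hev : ∀ᶠ x in nhds a, 1 / 2 < phiEpsDeriv ε x :=
    hcont.eventually (lt_mem_nhds (by rw [hval]; norm_num))
  by_contra! hlt
  have hae : ∀ᵐ x, ¬ 1 / 2 < phiEpsDeriv ε x := by
    rw [eLpNorm_exponent_top] at hlt
    filter_upwards [ae_lt_of_essSup_lt hlt] with x hx hx2
    rw [← ofReal_norm] at hx
    have hx3 := (ENNReal.ofReal_lt_ofReal_iff (by norm_num)).1 hx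
    exact absurd (Real.le_norm_self _) (not_le.2 (hx3.trans hx2))
  have hpos := Measure.measure_pos_of_mem_nhds volume hev
  rw [ae_iff] at hae
  simp only [not_not] at hae
  exact hpos.ne' hae

/-- For `ε ∈ (0, 1/2)`, the function `φ_ε(x) = x sin(ε log(1/|x|))` has
derivative `φ'_ε(x) = sin(ε log(1/|x|)) - ε cos(ε log(1/|x|))` for `x ≠ 0`; there are
absolute constants `C > 0` and `0 < c₁ ≤ c₂` with `[φ'_ε]_{BMO(ℝ)} ≤ C ε`, while
`c₁ ≤ ‖φ'_ε‖_{L_∞(ℝ)} ≤ c₂`, uniformly in `ε`. -/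
theorem stmt_19 :
    ∃ C : ℝ, 0 < C ∧ ∃ c₁ c₂ : ℝ, 0 < c₁ ∧ c₁ ≤ c₂ ∧
      ∀ ε : ℝ, 0 < ε → ε < 1 / 2 →
        (∀ x : ℝ, x ≠ 0 → HasDerivAt (phiEps ε) (phiEpsDeriv ε x) x) ∧
        bmoReal (phiEpsDeriv ε) ≤ ENNReal.ofReal (C * ε) ∧
        ENNReal.ofReal c₁ ≤ eLpNorm (phiEpsDeriv ε) ⊤ volume ∧
        eLpNorm (phiEpsDeriv ε) ⊤ volume ≤ ENNReal.ofReal c₂ := by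
  refine ⟨12, by norm_num, 1 / 2, 2, by norm_num, by norm_num, fun ε h0 h1 =>
    ⟨fun x hx => hasDerivAt_phiEps ε hx, bmoReal_phiEpsDeriv_le h0 h1,
      half_le_eLpNorm_phiEpsDeriv h0, ?_⟩⟩
  rw [eLpNorm_exponent_top]
  exact eLpNormEssSup_le_of_ae_bound (.of_forall fun x => abs_phiEpsDeriv_le h0 h1 x)
end
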